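/- arXiv:1002.1229 — 4 statements merged into one kernel-verified Lean document; each statement's English description precedes it below -/
import Mathlib

section
/- For every k ≥ 0, c_k = 1 + Σ_{i=0}^{k} d_i, where c_i is the number of featureless Schröder prefixes in 𝒟 terminating at (i,i) and d_i is the number of featureless Schröder prefixes in 𝒟 terminating at (i−1,i). -/
/-- A step of a lattice path: `E = (1,0)`, `N = (0,1)`, `D = (1,1)`. -/
inductive Step : Type
  | E : Step
  | N : Step
  | D : Step
  deriving DecidableEq

/-- The x-coordinate of the lattice point reached after performing the steps `q`
(starting from the origin). -/
def posX (q : List Step) : ℕ := q.count Step.E + q.count Step.D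

/-- The y-coordinate of the lattice point reached after performing the steps `q`
(starting from the origin). -/
def posY (q : List Step) : ℕ := q.count Step.N + q.count Step.D

/-- A Schröder prefix: a lattice path starting at the origin which never passes
below the line `y = x`. -/
def IsSchroderPrefix (p : List Step) : Prop :=
  ∀ q : List Step, q <+: p → posX q ≤ posY q

/-- A Schröder path of length `n`: a Schröder prefix terminating at `(n, n)`. -/
def IsSchroderPath (n : ℕ) (p : List Step) : Prop :=
  IsSchroderPrefix p ∧ posX p = n ∧ posY p = n

/-- Interchange `E` and `N` steps. -/
def revStep : Step → Step
  | Step.E => Step.N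
  | Step.N => Step.E
  | Step.D => Step.D

/-- The reversal of a Schröder path: write the steps in reverse order and
interchange `E` and `N` steps. -/
def revPath (p : List Step) : List Step := p.reverse.map revStep

/-- Words which are concatenations of blocks, each block being a single `D` step or
of the form `N^k E^k` for some `k > 0`. -/
inductive IsInnerWord : List Step → Prop
  | nil : IsInnerWord []
  | dcons {p : List Step} : IsInnerWord p → IsInnerWord (Step.D :: p)
  | peak {k : ℕ} {p : List Step} : 0 < k → IsInnerWord p →
      IsInnerWord (List.replicate k Step.N ++ List.replicate k Step.E ++ p)

/-- Words which are concatenations of blocks, each block being a single `D` step or of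
the form `N q E` where `q` is an inner word. -/
inductive IsDWord : List Step → Prop
  | nil : IsDWord []
  | dcons {p : List Step} : IsDWord p → IsDWord (Step.D :: p)
  | block {q p : List Step} : IsInnerWord q → IsDWord p →
      IsDWord (Step.N :: (q ++ Step.E :: p))

/-- Membership in `𝒟_n`: a Schröder path of length `n` of the prescribed block form. -/
def MemD (n : ℕ) (p : List Step) : Prop := IsDWord p ∧ IsSchroderPath n p

/-- Membership in `𝒟`: Schröder prefixes occurring as initial segments of some
path in `𝒟_m` for some finite `m`. -/
def MemCalD (p : List Step) : Prop := ∃ (m : ℕ) (q : List Step), p <+: q ∧ MemD m q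

/-- `p` has a level feature at `t`: a `D` step joining `(t-1, t)` to `(t, t+1)`. -/
def HasLevelFeatureAt (p : List Step) (t : ℕ) : Prop :=
  1 ≤ t ∧ ∃ q r : List Step, p = q ++ Step.D :: r ∧ posX q = t - 1 ∧ posY q = t

/-- `p` has a notch feature at `t`: an `E` step joining `(t-1, t)` to `(t, t)`
immediately followed by an `N` step joining `(t, t)` to `(t, t+1)`. -/
def HasNotchFeatureAt (p : List Step) (t : ℕ) : Prop :=
  1 ≤ t ∧ ∃ q r : List Step, p = q ++ Step.E :: Step.N :: r ∧ posX q = t - 1 ∧ posY q = t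

/-- `p` has no (level or notch) features. -/
def Featureless (p : List Step) : Prop :=
  ∀ t : ℕ, ¬ HasLevelFeatureAt p t ∧ ¬ HasNotchFeatureAt p t

/-- Auxiliary function for `psi`, processing the path left to right while keeping track of
the current height `y - x` above the diagonal: at height `1`, a `D` step (a level feature)
is replaced by `E N` (a notch feature) and vice versa; all other steps are unchanged. -/
def psiAux : ℕ → List Step → List Step
  | 1, Step.D :: rest => Step.E :: Step.N :: psiAux 1 rest
  | 1, Step.E :: Step.N :: rest => Step.D :: psiAux 1 rest
  | h, Step.N :: rest => Step.N :: psiAux (h + 1) rest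
  | h, Step.E :: rest => Step.E :: psiAux (h - 1) rest
  | h, Step.D :: rest => Step.D :: psiAux h rest
  | _, [] => []
  termination_by h l => l.length

/-- `psi p` replaces every level feature of `p` by a notch feature at the same place and
vice versa, leaving all other steps unchanged. -/
def psi (p : List Step) : List Step := psiAux 0 p

/-- `a i`: the number of Schröder prefixes in `𝒟` terminating at `(i, i)`. -/
noncomputable def aSeq (i : ℕ) : ℕ :=
  Set.ncard {p : List Step | MemCalD p ∧ posX p = i ∧ posY p = i}

/-- `b i`: the number of Schröder prefixes in `𝒟` terminating at `(i-1, i)` (and `b 0 = 0`). -/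
noncomputable def bSeq (i : ℕ) : ℕ :=
  Set.ncard {p : List Step | MemCalD p ∧ posX p + 1 = i ∧ posY p = i}

/-- `c i`: the number of featureless Schröder prefixes in `𝒟` terminating at `(i, i)`. -/
noncomputable def cSeq (i : ℕ) : ℕ :=
  Set.ncard {p : List Step | MemCalD p ∧ Featureless p ∧ posX p = i ∧ posY p = i}

/-- `d i`: the number of featureless Schröder prefixes in `𝒟` terminating at `(i-1, i)`
(and `d 0 = 0`). -/
noncomputable def dSeq (i : ℕ) : ℕ :=
  Set.ncard {p : List Step | MemCalD p ∧ Featureless p ∧ posX p + 1 = i ∧ posY p = i}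

/-- The permutation `π` (of `{1, …, n}`, 0-indexed as `Fin n`) contains the pattern `τ`
(a permutation of `{1, …, k}`, 0-indexed as `Fin k`). -/
def Contains {n k : ℕ} (π : Equiv.Perm (Fin n)) (τ : Equiv.Perm (Fin k)) : Prop :=
  ∃ f : Fin k → Fin n, StrictMono f ∧ ∀ a b : Fin k, τ a < τ b ↔ π (f a) < π (f b)

/-- The permutation `π` avoids the pattern `τ`. -/
def Avoids {n k : ℕ} (π : Equiv.Perm (Fin n)) (τ : Equiv.Perm (Fin k)) : Prop :=
  ¬ Contains π τ

/-- The reverse-complement of a permutation: `rc π (i) = (n+1) - π (n+1-i)` (1-indexed),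
i.e. `rc π (i) = rev (π (rev i))` in 0-indexed form. -/
def rc {n : ℕ} (π : Equiv.Perm (Fin n)) : Equiv.Perm (Fin n) :=
  (Fin.revPerm.trans π).trans Fin.revPerm

/-- The pattern `1243` (0-indexed: `0 ↦ 0, 1 ↦ 1, 2 ↦ 3, 3 ↦ 2`). -/
def pat1243 : Equiv.Perm (Fin 4) := Equiv.swap 2 3

/-- The pattern `2143` (0-indexed: `0 ↦ 1, 1 ↦ 0, 2 ↦ 3, 3 ↦ 2`). -/
def pat2143 : Equiv.Perm (Fin 4) := Equiv.swap 0 1 * Equiv.swap 2 3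

/-- The pattern `2134` (0-indexed: `0 ↦ 1, 1 ↦ 0, 2 ↦ 2, 3 ↦ 3`). -/
def pat2134 : Equiv.Perm (Fin 4) := Equiv.swap 0 1

theorem prefix_append_cases {α : Type*} {p a b : List α} (h : p <+: a ++ b) :
    p <+: a ∨ ∃ c, p = a ++ c ∧ c <+: b := by
  rcases List.prefix_or_prefix_of_prefix h (List.prefix_append a b) with h1 | ⟨c, rfl⟩
  · exact Or.inl h1
  · exact Or.inr ⟨c, rfl, (List.prefix_append_right_inj a).1 h⟩

theorem posX_append (a b : List Step) : posX (a ++ b) = posX a + posX b := by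
  simp [posX]; omega

theorem posY_append (a b : List Step) : posY (a ++ b) = posY a + posY b := by
  simp [posY]; omega

theorem posX_nil : posX [] = 0 := rfl
theorem posY_nil : posY [] = 0 := rfl
theorem posX_E (l : List Step) : posX (Step.E :: l) = posX l + 1 := by
  simp [posX]; omega
theorem posX_N (l : List Step) : posX (Step.N :: l) = posX l := by simp [posX]
theorem posX_D (l : List Step) : posX (Step.D :: l) = posX l + 1 := by
  simp [posX]; omega
theorem posY_E (l : List Step) : posY (Step.E :: l) = posY l := by simp [posY]
theorem posY_N (l : List Step) : posY (Step.N :: l) = posY l + 1 := by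
  simp [posY]; omega
theorem posY_D (l : List Step) : posY (Step.D :: l) = posY l + 1 := by
  simp [posY]; omega
theorem posX_rN (k : ℕ) : posX (List.replicate k Step.N) = 0 := by
  simp [posX, List.count_replicate]
theorem posY_rN (k : ℕ) : posY (List.replicate k Step.N) = k := by
  simp [posY, List.count_replicate]
theorem posX_rE (k : ℕ) : posX (List.replicate k Step.E) = k := by
  simp [posX, List.count_replicate]
theorem posY_rE (k : ℕ) : posY (List.replicate k Step.E) = 0 := by
  simp [posY, List.count_replicate]

theorem inner_facts {w : List Step} (hw : IsInnerWord w) : posX w = posY w ∧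
    ∀ p, p <+: w → posX p ≤ posY p ∧ (posX p = posY p → IsInnerWord p) := by
  induction hw with
  | nil =>
    refine ⟨rfl, fun p hp => ?_⟩
    rw [List.prefix_nil] at hp
    subst hp
    exact ⟨le_rfl, fun _ => .nil⟩
  | @dcons w hw ih =>
    refine ⟨by rw [posX_D, posY_D, ih.1], fun p hp => ?_⟩
    rcases List.prefix_cons_iff.1 hp with rfl | ⟨t, rfl, ht⟩
    · exact ⟨le_rfl, fun _ => .nil⟩
    · obtain ⟨h1, h2⟩ := ih.2 t ht
      rw [posX_D, posY_D]
      exact ⟨by omega, fun h => .dcons (h2 (by omega))⟩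
  | @peak k w hk hw ih =>
    refine ⟨by simp only [posX_append, posY_append, posX_rN, posY_rN, posX_rE, posY_rE, ih.1]; omega,
      fun p hp => ?_⟩
    rcases prefix_append_cases hp with hp | ⟨c, rfl, hc⟩
    · rcases prefix_append_cases hp with hp | ⟨c, rfl, hc⟩
      · obtain ⟨hj, he⟩ := List.prefix_replicate_iff.1 hp
        rw [he, posX_rN, posY_rN]
        refine ⟨by omega, fun h => ?_⟩
        rw [← h]
        exact .nil
      · obtain ⟨hj, he⟩ := List.prefix_replicate_iff.1 hc
        rw [he]
        simp only [posX_append, posY_append, posX_rN, posY_rN, posX_rE, posY_rE]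
        refine ⟨by omega, fun h => ?_⟩
        have h' : c.length = k := by omega
        rw [h']
        simpa using IsInnerWord.peak hk .nil
    · obtain ⟨h1, h2⟩ := ih.2 c hc
      simp only [posX_append, posY_append, posX_rN, posY_rN, posX_rE, posY_rE]
      exact ⟨by omega, fun h => .peak hk (h2 (by omega))⟩

theorem dword_facts {w : List Step} (hw : IsDWord w) : posX w = posY w ∧
    ∀ p, p <+: w → posX p ≤ posY p ∧ (posX p = posY p → IsDWord (p ++ [Step.D])) ∧
      (posX p + 1 = posY p → IsDWord (p ++ [Step.E])) := by
  induction hw with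
  | nil =>
    refine ⟨rfl, fun p hp => ?_⟩
    rw [List.prefix_nil] at hp
    subst hp
    exact ⟨le_rfl, fun _ => .dcons .nil, fun h => by simp [posX_nil, posY_nil] at h⟩
  | @dcons w hw ih =>
    refine ⟨by rw [posX_D, posY_D, ih.1], fun p hp => ?_⟩
    rcases List.prefix_cons_iff.1 hp with rfl | ⟨t, rfl, ht⟩
    · exact ⟨le_rfl, fun _ => .dcons .nil, fun h => by simp [posX_nil, posY_nil] at h⟩
    · obtain ⟨h1, h2, h3⟩ := ih.2 t ht
      rw [posX_D, posY_D]
      exact ⟨by omega, fun h => .dcons (h2 (by omega)), fun h => .dcons (h3 (by omega))⟩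
  | @block q w hq hw ih =>
    have hi := inner_facts hq
    refine ⟨by simp only [posX_N, posY_N, posX_append, posY_append, posX_E, posY_E, ih.1, hi.1]; omega,
      fun p hp => ?_⟩
    rcases List.prefix_cons_iff.1 hp with rfl | ⟨t, rfl, ht⟩
    · exact ⟨le_rfl, fun _ => .dcons .nil, fun h => by simp [posX_nil, posY_nil] at h⟩
    have key : ∀ t, t <+: q → posX (Step.N :: t) ≤ posY (Step.N :: t) ∧
        (posX (Step.N :: t) = posY (Step.N :: t) → IsDWord ((Step.N :: t) ++ [Step.D])) ∧
        (posX (Step.N :: t) + 1 = posY (Step.N :: t) → IsDWord ((Step.N :: t) ++ [Step.E])) := by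
      intro t ht
      obtain ⟨h1, h2⟩ := hi.2 t ht
      rw [posX_N, posY_N]
      exact ⟨by omega, fun h => by omega, fun h => .block (h2 (by omega)) .nil⟩
    rcases prefix_append_cases ht with ht | ⟨c, rfl, hc⟩
    · exact key t ht
    · rcases List.prefix_cons_iff.1 hc with rfl | ⟨t, rfl, hu⟩
      · rw [List.append_nil]
        exact key q List.prefix_rfl
      · obtain ⟨h1, h2, h3⟩ := ih.2 t hu
        simp only [posX_N, posY_N, posX_append, posY_append, posX_E, posY_E, hi.1]
        refine ⟨by omega, fun h => ?_, fun h => ?_⟩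
        · have := IsDWord.block hq (h2 (by omega))
          simpa using this
        · have := IsDWord.block hq (h3 (by omega))
          simpa using this

theorem IsDWord.memCalD {w : List Step} (hw : IsDWord w) : MemCalD w :=
  ⟨posX w, w, List.prefix_rfl, hw, fun q hq => ((dword_facts hw).2 q hq).1, rfl,
    (dword_facts hw).1.symm⟩

theorem MemCalD.le {p : List Step} (h : MemCalD p) : posX p ≤ posY p := by
  obtain ⟨m, q, hp, hq, -⟩ := h
  exact ((dword_facts hq).2 p hp).1

theorem MemCalD.appD {p : List Step} (h : MemCalD p) (h0 : posX p = posY p) :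
    MemCalD (p ++ [Step.D]) := by
  obtain ⟨m, q, hp, hq, -⟩ := h
  exact (((dword_facts hq).2 p hp).2.1 h0).memCalD

theorem MemCalD.appE {p : List Step} (h : MemCalD p) (h0 : posX p + 1 = posY p) :
    MemCalD (p ++ [Step.E]) := by
  obtain ⟨m, q, hp, hq, -⟩ := h
  exact (((dword_facts hq).2 p hp).2.2 h0).memCalD

theorem MemCalD.of_prefix {p q : List Step} (h : MemCalD q) (hp : p <+: q) : MemCalD p := by
  obtain ⟨m, w, hq, hw⟩ := h
  exact ⟨m, w, hp.trans hq, hw⟩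

theorem Featureless.of_append {p s : List Step} (h : Featureless (p ++ s)) : Featureless p := by
  intro t
  constructor
  · rintro ⟨ht, q, r, rfl, hx, hy⟩
    exact (h t).1 ⟨ht, q, r ++ s, by simp, hx, hy⟩
  · rintro ⟨ht, q, r, rfl, hx, hy⟩
    exact (h t).2 ⟨ht, q, r ++ s, by simp, hx, hy⟩

theorem featureless_snoc {p : List Step} {a : Step} (h : Featureless p) (ha : a ≠ Step.N)
    (hD : a = Step.D → posX p = posY p) : Featureless (p ++ [a]) := by
  intro t
  constructor
  · rintro ⟨ht, q, r, he, hx, hy⟩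
    rcases List.eq_nil_or_concat r with rfl | ⟨r, b, rfl⟩
    · obtain ⟨rfl, h2⟩ := List.append_inj' he rfl
      have := hD (by simpa using h2)
      omega
    · have he' : p ++ [a] = (q ++ Step.D :: r) ++ [b] := by simpa using he
      obtain ⟨rfl, -⟩ := List.append_inj' he' rfl
      exact (h t).1 ⟨ht, q, r, rfl, hx, hy⟩
  · rintro ⟨ht, q, r, he, hx, hy⟩
    rcases List.eq_nil_or_concat r with rfl | ⟨r, b, rfl⟩
    · have he' : p ++ [a] = (q ++ [Step.E]) ++ [Step.N] := by simpa using he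
      obtain ⟨-, h2⟩ := List.append_inj' he' rfl
      exact ha (by simpa using h2)
    · have he' : p ++ [a] = (q ++ Step.E :: Step.N :: r) ++ [b] := by simpa using he
      obtain ⟨rfl, -⟩ := List.append_inj' he' rfl
      exact (h t).2 ⟨ht, q, r, rfl, hx, hy⟩

theorem length_le (p : List Step) : p.length ≤ posX p + posY p := by
  induction p with
  | nil => simp
  | cons a p ih =>
    cases a <;> simp only [posX_E, posX_N, posX_D, posY_E, posY_N, posY_D, List.length_cons] <;> omega

theorem finite_of_bound (S : Set (List Step)) (n : ℕ) (h : ∀ p ∈ S, posX p ≤ n ∧ posY p ≤ n) :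
    S.Finite := by
  haveI : Finite Step := Finite.of_injective
    (fun s : Step => (Step.casesOn s 0 1 2 : Fin 3)) (by
      intro a b; cases a <;> cases b <;> simp)
  refine (List.finite_length_le Step (n + n)).subset fun p hp => ?_
  have := h p hp
  have := length_le p
  simp only [Set.mem_setOf_eq]
  omega

theorem cSeq_succ (k : ℕ) : cSeq (k + 1) = cSeq k + dSeq (k + 1) := by
  unfold cSeq dSeq
  set C := {p : List Step | MemCalD p ∧ Featureless p ∧ posX p = k ∧ posY p = k} with hC
  set F := {p : List Step | MemCalD p ∧ Featureless p ∧ posX p + 1 = k + 1 ∧ posY p = k + 1} with hF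
  have hCf : C.Finite := finite_of_bound C (k + 1) (by
    rintro p ⟨-, -, h1, h2⟩; omega)
  have hFf : F.Finite := finite_of_bound F (k + 1) (by
    rintro p ⟨-, -, h1, h2⟩; omega)
  have hinj : ∀ a : Step, Function.Injective (fun p : List Step => p ++ [a]) :=
    fun a p q h => (List.append_inj' h rfl).1
  have hset : {p : List Step | MemCalD p ∧ Featureless p ∧ posX p = k + 1 ∧ posY p = k + 1} =
      (fun p => p ++ [Step.D]) '' C ∪ (fun p => p ++ [Step.E]) '' F := by
    ext p
    constructor
    · rintro ⟨hm, hf, hx, hy⟩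
      rcases List.eq_nil_or_concat p with rfl | ⟨p, b, rfl⟩
      · simp [posX_nil] at hx
      · rw [List.concat_eq_append] at *
        have hm' := hm.of_prefix (List.prefix_append p [b])
        have hle := hm'.le
        rw [posX_append] at hx
        rw [posY_append] at hy
        cases b
        · rw [posX_E, posX_nil] at hx
          rw [posY_E, posY_nil] at hy
          exact Or.inr ⟨p, ⟨hm', hf.of_append, by omega, by omega⟩, rfl⟩
        · rw [posX_N, posX_nil] at hx
          rw [posY_N, posY_nil] at hy
          omega
        · rw [posX_D, posX_nil] at hx
          rw [posY_D, posY_nil] at hy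
          exact Or.inl ⟨p, ⟨hm', hf.of_append, by omega, by omega⟩, rfl⟩
    · rintro (⟨p, ⟨hm, hf, hx, hy⟩, rfl⟩ | ⟨p, ⟨hm, hf, hx, hy⟩, rfl⟩)
      · refine ⟨hm.appD (by omega), featureless_snoc hf (by simp) (fun _ => by omega), ?_, ?_⟩
        · simp only [posX_append, posX_D, posX_nil]; omega
        · simp only [posY_append, posY_D, posY_nil]; omega
      · refine ⟨hm.appE (by omega), featureless_snoc hf (by simp) (by simp), ?_, ?_⟩
        · simp only [posX_append, posX_E, posX_nil]; omega
        · simp only [posY_append, posY_E, posY_nil]; omega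
  rw [hset, Set.ncard_union_eq ?_ (hCf.image _) (hFf.image _),
    Set.ncard_image_of_injective _ (hinj _), Set.ncard_image_of_injective _ (hinj _)]
  rw [Set.disjoint_left]
  rintro _ ⟨p, -, rfl⟩ ⟨q, -, h⟩
  have := (List.append_inj' h rfl).2
  simp at this

theorem cSeq_zero : cSeq 0 = 1 := by
  unfold cSeq
  rw [Set.ncard_eq_one]
  refine ⟨[], ?_⟩
  ext p
  simp only [Set.mem_setOf_eq, Set.mem_singleton_iff]
  constructor
  · rintro ⟨-, -, hx, hy⟩
    have := length_le p
    exact List.length_eq_zero_iff.1 (by omega)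
  · rintro rfl
    refine ⟨IsDWord.nil.memCalD, fun t => ⟨?_, ?_⟩, rfl, rfl⟩
    · rintro ⟨-, q, r, h, -⟩
      simp at h
    · rintro ⟨-, q, r, h, -⟩
      simp at h

theorem dSeq_zero : dSeq 0 = 0 := by
  unfold dSeq
  simp

theorem stmt_13 :
    ∀ k : ℕ, cSeq k = 1 + ∑ i ∈ Finset.range (k + 1), dSeq i := by
  intro k
  induction k with
  | zero => simp [cSeq_zero, dSeq_zero]
  | succ k ih => rw [cSeq_succ, Finset.sum_range_succ, ih]; omega
end

section
/- For every n ≥ 1, the number of Schröder paths p ∈ D_{2n} satisfying rev(p) = p and having no features equals d_{n+1}, where d_i is the number of featureless Schröder prefixes in 𝒟 terminating at (i−1,i). -/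
namespace S16

def peaks : List ℕ → List Step
  | [] => []
  | k :: c => List.replicate k Step.N ++ (List.replicate k Step.E ++ peaks c)

def flat : List (Option (List ℕ)) → List Step
  | [] => []
  | none :: L => Step.D :: flat L
  | some c :: L => Step.N :: (peaks c ++ Step.E :: flat L)

def bs : Option (List ℕ) → ℕ
  | none => 1
  | some c => c.sum + 1

def size (L : List (Option (List ℕ))) : ℕ := (L.map bs).sum

def PosB (b : Option (List ℕ)) : Prop := ∀ c, b = some c → ∀ k ∈ c, 0 < k

def PosL (L : List (Option (List ℕ))) : Prop := ∀ b ∈ L, PosB b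

def Rel (a b : Option (List ℕ)) : Prop := a = none ∨ b = none

def Good (L : List (Option (List ℕ))) : Prop := PosL L ∧ List.IsChain Rel L

def ok : ℤ → List Step → Prop
  | _, [] => True
  | h, Step.D :: r => h ≠ 1 ∧ ok h r
  | h, Step.N :: r => ok (h+1) r
  | h, Step.E :: r => (h = 1 → r.head? ≠ some Step.N) ∧ ok (h-1) r

def sp : ℕ → List Step → Prop
  | _, [] => True
  | h, Step.D :: r => sp h r
  | h, Step.N :: r => sp (h+1) r
  | 0, Step.E :: _ => False
  | h+1, Step.E :: r => sp h r

@[simp] theorem posX_nil : posX [] = 0 := rfl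
@[simp] theorem posY_nil : posY [] = 0 := rfl
@[simp] theorem posX_append (a b) : posX (a ++ b) = posX a + posX b := by
  simp [posX]; omega
@[simp] theorem posY_append (a b) : posY (a ++ b) = posY a + posY b := by
  simp [posY]; omega
@[simp] theorem posX_E (a) : posX (Step.E :: a) = posX a + 1 := by simp [posX]; omega
@[simp] theorem posX_N (a) : posX (Step.N :: a) = posX a := by simp [posX]
@[simp] theorem posX_D (a) : posX (Step.D :: a) = posX a + 1 := by simp [posX]; omega
@[simp] theorem posY_E (a) : posY (Step.E :: a) = posY a := by simp [posY]
@[simp] theorem posY_N (a) : posY (Step.N :: a) = posY a + 1 := by simp [posY]; omega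
@[simp] theorem posY_D (a) : posY (Step.D :: a) = posY a + 1 := by simp [posY]; omega
@[simp] theorem posX_rN (k) : posX (List.replicate k Step.N) = 0 := by
  induction k <;> simp_all [List.replicate_succ]
@[simp] theorem posX_rE (k) : posX (List.replicate k Step.E) = k := by
  induction k <;> simp_all [List.replicate_succ]
@[simp] theorem posY_rN (k) : posY (List.replicate k Step.N) = k := by
  induction k <;> simp_all [List.replicate_succ]
@[simp] theorem posY_rE (k) : posY (List.replicate k Step.E) = 0 := by
  induction k <;> simp_all [List.replicate_succ]

theorem pos_peaks (c) : posX (peaks c) = c.sum ∧ posY (peaks c) = c.sum := by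
  induction c with
  | nil => simp [peaks]
  | cons k c ih => simp [peaks, ih]

theorem pos_flat (L) : posX (flat L) = size L ∧ posY (flat L) = size L := by
  induction L with
  | nil => simp [flat, size]
  | cons b L ih =>
    simp only [size] at ih
    cases b with
    | none => simp [flat, size, bs, ih]; omega
    | some c => simp [flat, size, bs, ih, pos_peaks]; omega

theorem flat_append (L M) : flat (L ++ M) = flat L ++ flat M := by
  induction L with
  | nil => simp [flat]
  | cons b L ih => cases b <;> simp [flat, ih]

theorem peaks_append (L M) : peaks (L ++ M) = peaks L ++ peaks M := by
  induction L with
  | nil => simp [peaks]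
  | cons b L ih => simp [peaks, ih]

theorem size_append (L M) : size (L ++ M) = size L + size M := by simp [size]

/-! ok -/
theorem ok_rN (k : ℕ) (h : ℤ) (x) : ok h (List.replicate k Step.N ++ x) ↔ ok (h + k) x := by
  induction k generalizing h with
  | zero => simp
  | succ k ih =>
    simp only [List.replicate_succ, List.cons_append, ok, ih]
    push_cast
    rw [show h + 1 + (k:ℤ) = h + (k + 1) by ring]

theorem ok_rE (k : ℕ) (h : ℤ) (hh : 1 ≤ h) (x) :
    ok (h + k) (List.replicate k Step.E ++ x) ↔ ok h x := by
  induction k with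
  | zero => simp
  | succ k ih =>
    simp only [List.replicate_succ, List.cons_append, ok]
    push_cast
    rw [show h + ((k:ℤ) + 1) - 1 = h + k by ring, ih]
    constructor
    · exact fun a => a.2
    · exact fun a => ⟨fun e => by omega, a⟩

theorem ok_peaks (c x) : ok 1 (peaks c ++ x) ↔ ok 1 x := by
  induction c with
  | nil => simp [peaks]
  | cons k c ih =>
    simp only [peaks, List.append_assoc]
    rw [ok_rN, ok_rE _ _ le_rfl, ih]

theorem ok_flat (L) : ok 0 (flat L) ↔ List.IsChain Rel L := by
  induction L with
  | nil => simp [flat, ok]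
  | cons b L ih =>
    cases b with
    | none =>
      simp only [flat, ok, ih]
      cases L with
      | nil => simp
      | cons b' L => simp [Rel]
    | some c =>
      simp only [flat, ok, zero_add, ok_peaks, sub_self, ih]
      cases L with
      | nil => simp [flat]
      | cons b' L => cases b' <;> simp [Rel, flat]

theorem ok_snocE (p : List Step) (h : ℤ) : ok h (p ++ [Step.E]) ↔ ok h p := by
  induction p generalizing h with
  | nil => simp [ok]
  | cons s p ih =>
    cases s
    · cases p with
      | nil => simp [ok]
      | cons t p => rw [List.cons_append, ok, ok, ih]; simp
    · simp [ok, ih]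
    · simp [ok, ih]

theorem ok_iff (p : List Step) (h : ℤ) : ok h p ↔
    (∀ q r, p = q ++ Step.D :: r → h + posY q - posX q ≠ 1) ∧
    (∀ q r, p = q ++ Step.E :: Step.N :: r → h + posY q - posX q ≠ 1) := by
  induction p generalizing h with
  | nil => simp [ok]
  | cons s p ih =>
    have key : ∀ (P : List Step → List Step → Prop), (∀ q r, P q r) ↔ (∀ r, P [] r) ∧ ∀ q r a, P (a :: q) r := by
      intro P
      constructor
      · intro H; exact ⟨fun r => H _ _, fun q r a => H _ _⟩
      · rintro ⟨h1, h2⟩ q r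
        cases q
        · exact h1 r
        · exact h2 _ _ _
    rw [key, key (fun q r => s :: p = q ++ Step.E :: Step.N :: r → _)]
    cases s
    · simp only [ok, ih]
      have : (h = 1 → p.head? ≠ some Step.N) ↔ ∀ r, p = Step.N :: r → h ≠ 1 := by
        cases p with
        | nil => simp
        | cons t p => cases t <;> simp
      rw [this]
      simp
      have e : ∀ a b : ℤ, h + a - (b + 1) = h - 1 + a - b := by intros; ring
      simp only [e]
      tauto
    · simp only [ok, ih]
      simp
      have e : ∀ a b : ℤ, h + (a + 1) - b = h + 1 + a - b := by intros; ring
      simp only [e]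
    · simp only [ok, ih]
      simp
      have e : ∀ a b : ℤ, h + (a + 1) - (b + 1) = h + a - b := by intros; ring
      simp only [e]
      tauto

theorem featureless_iff (p) : Featureless p ↔ ok 0 p := by
  rw [ok_iff]
  constructor
  · intro H
    refine ⟨fun q r e he => ?_, fun q r e he => ?_⟩
    · exact (H (posY q)).1 ⟨by omega, q, r, e, by omega, rfl⟩
    · exact (H (posY q)).2 ⟨by omega, q, r, e, by omega, rfl⟩
  · rintro ⟨h1, h2⟩ t
    refine ⟨?_, ?_⟩
    · rintro ⟨ht, q, r, e, a, b⟩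
      exact h1 q r e (by omega)
    · rintro ⟨ht, q, r, e, a, b⟩
      exact h2 q r e (by omega)

/-! Schroder -/
theorem sp_rN (k h : ℕ) (x) : sp h (List.replicate k Step.N ++ x) ↔ sp (h + k) x := by
  induction k generalizing h with
  | zero => simp
  | succ k ih =>
    simp only [List.replicate_succ, List.cons_append, sp, ih]
    rw [show h + 1 + k = h + (k + 1) by ring]

theorem sp_rE (k h : ℕ) (x) : sp (h + k) (List.replicate k Step.E ++ x) ↔ sp h x := by
  induction k with
  | zero => simp
  | succ k ih =>
    simp only [List.replicate_succ, List.cons_append, ← Nat.add_assoc, sp, ih]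

theorem sp_peaks (c h x) : sp h (peaks c ++ x) ↔ sp h x := by
  induction c with
  | nil => simp [peaks]
  | cons k c ih =>
    simp only [peaks, List.append_assoc]
    rw [sp_rN, sp_rE, ih]

theorem sp_flat (L) : sp 0 (flat L) := by
  induction L with
  | nil => simp [flat, sp]
  | cons b L ih =>
    cases b with
    | none => simpa [flat, sp] using ih
    | some c => simp only [flat, sp, sp_peaks]; exact ih

theorem sp_prefix (p h) (H : sp h p) : ∀ q, q <+: p → posX q ≤ posY q + h := by
  induction p generalizing h with
  | nil => intro q hq; simp at hq; simp [hq]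
  | cons s p ih =>
    intro q hq
    rw [List.prefix_cons_iff] at hq
    rcases hq with rfl | ⟨t, rfl, ht⟩
    · simp
    · cases s
      · cases h with
        | zero => simp [sp] at H
        | succ h => have := ih h H t ht; simp; omega
      · have := ih _ H t ht; simp; omega
      · have := ih _ H t ht; simp; omega

/-! words -/
theorem inner_peaks (c : List ℕ) (hc : ∀ k ∈ c, 0 < k) : IsInnerWord (peaks c) := by
  induction c with
  | nil => exact .nil
  | cons k c ih =>
    simp only [peaks, ← List.append_assoc]
    exact .peak (hc k (by simp)) (ih fun k hk => hc k (by simp [hk]))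

theorem posL_cons (b L) : PosL (b :: L) ↔ PosB b ∧ PosL L := by simp [PosL]
theorem posL_append (M L) : PosL (M ++ L) ↔ PosL M ∧ PosL L := by
  simp [PosL, or_imp, forall_and]
theorem posB_some (c) : PosB (some c) ↔ ∀ k ∈ c, 0 < k := by simp [PosB]
theorem posB_none : PosB none := by simp [PosB]

theorem dword_flat (L) (h : PosL L) : IsDWord (flat L) := by
  induction L with
  | nil => exact .nil
  | cons b L ih =>
    rw [posL_cons] at h
    cases b with
    | none => exact .dcons (ih h.2)
    | some c => exact .block (inner_peaks c ((posB_some c).1 h.1)) (ih h.2)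

theorem inner_ok {q} (hq : IsInnerWord q) (x) (h : ok 1 (q ++ x)) :
    ∃ c : List ℕ, (∀ k ∈ c, 0 < k) ∧ q = peaks c ∧ ok 1 x := by
  induction hq with
  | nil => exact ⟨[], by simp, rfl, h⟩
  | dcons _ ih => simp [ok] at h
  | @peak k p hk _ ih =>
    simp only [List.append_assoc] at h
    rw [ok_rN, ok_rE _ _ le_rfl] at h
    obtain ⟨c, h1, rfl, h3⟩ := ih h
    exact ⟨k :: c, by simpa using ⟨hk, h1⟩, by simp [peaks], h3⟩

theorem dword_ok {p} (hp : IsDWord p) (h : ok 0 p) : ∃ L, Good L ∧ p = flat L := by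
  suffices ∃ L, PosL L ∧ p = flat L by
    obtain ⟨L, h1, rfl⟩ := this
    exact ⟨L, ⟨h1, (ok_flat L).1 h⟩, rfl⟩
  induction hp with
  | nil => exact ⟨[], by simp [PosL], rfl⟩
  | dcons _ ih =>
    obtain ⟨L, h1, rfl⟩ := ih h.2
    exact ⟨none :: L, (posL_cons _ _).2 ⟨posB_none, h1⟩, rfl⟩
  | block hq _ ih =>
    simp only [ok, zero_add] at h
    obtain ⟨c, h1, rfl, h3⟩ := inner_ok hq _ h
    obtain ⟨L, h1', rfl⟩ := ih (by simpa [ok] using h3.2)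
    exact ⟨some c :: L, (posL_cons _ _).2 ⟨(posB_some c).2 h1, h1'⟩, rfl⟩

theorem inner_pos {q} (hq : IsInnerWord q) : posX q = posY q := by
  induction hq with
  | nil => rfl
  | dcons _ ih => simp [ih]
  | peak _ _ ih => simp [ih]

theorem pre_app {r a b : List Step} (h : r <+: a ++ b) : r <+: a ∨ ∃ s, r = a ++ s ∧ s <+: b := by
  rcases List.prefix_or_prefix_of_prefix h (List.prefix_append a b) with h1 | ⟨s, rfl⟩
  · exact .inl h1
  · exact .inr ⟨s, rfl, (List.prefix_append_right_inj a).1 h⟩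

theorem inner_pre {q} (hq : IsInnerWord q) : ∀ r, r <+: q → posX r = posY r → IsInnerWord r := by
  induction hq with
  | nil => intro r hr _; simp at hr; subst hr; exact .nil
  | dcons _ ih =>
    intro r hr h
    rw [List.prefix_cons_iff] at hr
    rcases hr with rfl | ⟨t, rfl, ht⟩
    · exact .nil
    · exact .dcons (ih t ht (by simpa using h))
  | @peak k p hk _ ih =>
    intro r hr h
    rcases pre_app hr with h1 | ⟨s, rfl, hs⟩
    · rcases pre_app h1 with h1 | ⟨s, rfl, hs⟩
      · rw [List.prefix_replicate_iff] at h1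
        rw [h1.2] at h
        simp at h
        rw [h1.2, ← h]; exact .nil
      · rw [List.prefix_replicate_iff] at hs
        rw [hs.2] at h
        simp at h
        rw [hs.2, h]
        simpa using IsInnerWord.peak hk .nil
    · exact .peak hk (ih s hs (by simpa using h))

theorem dword_pre {q} (hq : IsDWord q) : ∀ r, r <+: q → posY r = posX r + 1 →
    IsDWord (r ++ [Step.E]) := by
  induction hq with
  | nil => intro r hr h; simp at hr; subst hr; simp at h
  | dcons _ ih =>
    intro r hr h
    rw [List.prefix_cons_iff] at hr
    rcases hr with rfl | ⟨t, rfl, ht⟩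
    · simp at h
    · exact .dcons (ih t ht (by simpa using h))
  | @block q p hq _ ih =>
    intro r hr h
    rw [List.prefix_cons_iff] at hr
    rcases hr with rfl | ⟨t, rfl, ht⟩
    · simp at h
    · simp at h
      rcases pre_app ht with h1 | ⟨s, rfl, hs⟩
      · exact .block (inner_pre hq t h1 h.symm) .nil
      · rw [List.prefix_cons_iff] at hs
        rcases hs with rfl | ⟨s, rfl, hs⟩
        · simpa using IsDWord.block hq .nil
        · have := inner_pos hq
          have := IsDWord.block hq (ih s hs (by simp at h; omega))
          simpa using this

/-! injectivity -/
theorem rep_inj (k l : ℕ) (x y : List Step)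
    (h : List.replicate k Step.N ++ Step.E :: x = List.replicate l Step.N ++ Step.E :: y) : k = l := by
  induction k generalizing l with
  | zero => cases l with
    | zero => rfl
    | succ l => simp [List.replicate_succ] at h
  | succ k ih => cases l with
    | zero => simp [List.replicate_succ] at h
    | succ l => simp [List.replicate_succ] at h; rw [ih l h]

theorem peaks_inj (c c' : List ℕ) (hc : ∀ k ∈ c, 0 < k) (hc' : ∀ k ∈ c', 0 < k) (x y)
    (h : peaks c ++ Step.E :: x = peaks c' ++ Step.E :: y) : c = c' ∧ x = y := by
  induction c generalizing c' with
  | nil => cases c' with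
    | nil => simpa [peaks] using h
    | cons l c' =>
      obtain ⟨l, rfl⟩ : ∃ m, l = m + 1 := ⟨l - 1, by have := hc' l (by simp); omega⟩
      simp [peaks, List.replicate_succ] at h
  | cons k c ih =>
    obtain ⟨k, rfl⟩ : ∃ m, k = m + 1 := ⟨k - 1, by have := hc k (by simp); omega⟩
    cases c' with
    | nil => simp [peaks, List.replicate_succ] at h
    | cons l c' =>
      obtain ⟨l, rfl⟩ : ∃ m, l = m + 1 := ⟨l - 1, by have := hc' l (by simp); omega⟩
      simp only [peaks, List.append_assoc] at h
      have := rep_inj (k+1) (l+1) (List.replicate k Step.E ++ (peaks c ++ Step.E :: x))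
        (List.replicate l Step.E ++ (peaks c' ++ Step.E :: y)) (by simpa [List.replicate_succ] using h)
      rw [this] at h ⊢
      simp only [List.append_cancel_left_eq] at h
      have := ih c' (fun k hk => hc k (by simp [hk])) (fun k hk => hc' k (by simp [hk])) h
      simp [this]

theorem flat_inj (L M) (hL : PosL L) (hM : PosL M) (h : flat L = flat M) : L = M := by
  induction L generalizing M with
  | nil => cases M with
    | nil => rfl
    | cons b M => cases b <;> simp [flat] at h
  | cons a L ih => cases M with
    | nil => cases a <;> simp [flat] at h
    | cons b M =>
      rw [posL_cons] at hL hM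
      cases a <;> cases b <;> simp [flat] at h
      · rw [ih M hL.2 hM.2 h]
      · obtain ⟨rfl, h2⟩ := peaks_inj _ _ ((posB_some _).1 hL.1) ((posB_some _).1 hM.1) _ _ h
        rw [ih M hL.2 hM.2 h2]

/-! reversal -/
def rb (b : Option (List ℕ)) : Option (List ℕ) := b.map List.reverse

def rl (L : List (Option (List ℕ))) : List (Option (List ℕ)) := L.reverse.map rb

theorem revPath_append (a b) : revPath (a ++ b) = revPath b ++ revPath a := by simp [revPath]

theorem revPath_peaks (c) : revPath (peaks c) = peaks c.reverse := by
  induction c with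
  | nil => rfl
  | cons k c ih =>
    rw [List.reverse_cons, peaks_append, ← ih]
    simp [peaks, revPath, revStep]

theorem revPath_flat (L) : revPath (flat L) = flat (rl L) := by
  induction L with
  | nil => rfl
  | cons b L ih =>
    have : rl (b :: L) = rl L ++ [rb b] := by simp [rl]
    rw [this, flat_append, ← ih]
    cases b with
    | none => simp [flat, rb, revPath, revStep]
    | some c =>
      simp only [rb, Option.map, flat, ← revPath_peaks]
      simp [revPath, revStep]

theorem posB_rb (b) : PosB (rb b) ↔ PosB b := by
  cases b <;> simp [rb, PosB]

theorem posL_rl (L) : PosL (rl L) ↔ PosL L := by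
  simp [rl, PosL, posB_rb]

theorem rb_none (b) : rb b = none ↔ b = none := by cases b <;> simp [rb]

theorem chain_rl (L) : List.IsChain Rel (rl L) ↔ List.IsChain Rel L := by
  have e : ∀ a b, Rel (rb a) (rb b) ↔ Rel b a := by
    intro a b; simp only [Rel, rb_none]; tauto
  rw [rl, List.isChain_map, List.isChain_reverse]
  simp only [flip, e]

theorem size_rl (L) : size (rl L) = size L := by
  have : bs ∘ rb = bs := by
    funext b; cases b <;> simp [rb, bs]
  simp [size, rl, this]

theorem rb_rb (b) : rb (rb b) = b := by cases b <;> simp [rb]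
theorem rl_rl (L) : rl (rl L) = L := by
  have : rb ∘ rb = id := by funext b; simp [rb_rb]
  simp [rl, this]
theorem rl_append (L M) : rl (L ++ M) = rl M ++ rl L := by simp [rl]

theorem pal {α : Type} (σ : α → α) (L : List α) (h : L.reverse.map σ = L) :
    (∃ M, L = M ++ M.reverse.map σ) ∨ ∃ M b, σ b = b ∧ L = M ++ b :: M.reverse.map σ := by
  obtain ⟨A, R, rfl, hl⟩ : ∃ A R, L = A ++ R ∧ (R.length = A.length ∨ R.length = A.length + 1) :=
    ⟨L.take (L.length / 2), L.drop (L.length / 2), by simp, by simp; omega⟩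
  rcases hl with hl | hl
  · left
    refine ⟨A, ?_⟩
    rw [List.reverse_append, List.map_append] at h
    have := List.append_inj h (by simp [hl])
    rw [this.2]
  · right
    cases R with
    | nil => simp at hl
    | cons b R =>
      refine ⟨A, b, ?_⟩
      simp only [List.reverse_append, List.reverse_cons, List.map_append, List.append_assoc] at h
      have := List.append_inj h (by simpa using hl)
      have := this.2
      simp at this
      exact ⟨this.1, by simp [this.2]⟩

/-! the bijection -/
def Phi : List (Option (List ℕ)) × List ℕ → List (Option (List ℕ))
  | (M, []) => M ++ rl M
  | (M, k :: c) => M ++ some (c.reverse ++ (2 * k - 1) :: c) :: rl M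

def T (n : ℕ) : Set (List (Option (List ℕ)) × List ℕ) :=
  {x | Good (x.1 ++ [some x.2]) ∧ size x.1 + x.2.sum = n}

theorem good_snoc (M c) : Good (M ++ [some c]) ↔
    PosL M ∧ (∀ k ∈ c, 0 < k) ∧ List.IsChain Rel M ∧ ∀ b ∈ M.getLast?, b = none := by
  simp only [Good, posL_append, posL_cons, posB_some, List.isChain_append]
  simp [PosL, Rel]
  tauto

theorem head_rl (M) : (rl M).head? = M.getLast?.map rb := by
  simp [rl]

theorem good_mid (M) (c) : Good (M ++ some c :: rl M) ↔ Good (M ++ [some c]) := by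
  rw [good_snoc]
  simp only [Good, posL_append, posL_cons, posB_some, List.isChain_append, List.isChain_cons,
    posL_rl, chain_rl, head_rl]
  simp [Rel]
  constructor
  · rintro ⟨⟨a, b, c⟩, d, ⟨e, f⟩, g⟩
    exact ⟨a, b, d, g⟩
  · rintro ⟨a, b, c, d⟩
    exact ⟨⟨a, b, a⟩, c, ⟨fun x hx => (rb_none _).2 (d x hx), c⟩, d⟩

theorem good_even (M) : Good (M ++ rl M) ↔ Good (M ++ [some []]) := by
  rw [good_snoc]
  simp only [Good, posL_append, List.isChain_append, posL_rl, chain_rl, head_rl]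
  cases h : M.getLast? with
  | none => simp
  | some b => simp [Rel, rb_none]

theorem rl_cons (b L) : rl (b :: L) = rl L ++ [rb b] := by simp [rl]

theorem Phi_spec (n : ℕ) (x) (hx : x ∈ T n) :
    Good (Phi x) ∧ rl (Phi x) = Phi x ∧ size (Phi x) = 2 * n := by
  obtain ⟨M, c⟩ := x
  obtain ⟨h1, h2⟩ := hx
  simp only at h1 h2
  cases c with
  | nil =>
    refine ⟨(good_even M).2 h1, by simp [Phi, rl_append, rl_rl], ?_⟩
    simp at h2
    simp [Phi, size_append, size_rl, h2]; omega
  | cons k c =>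
    rw [good_snoc] at h1
    have hk : 0 < k := h1.2.1 k (by simp)
    refine ⟨(good_mid M _).2 ((good_snoc _ _).2 ⟨h1.1, ?_, h1.2.2⟩), ?_, ?_⟩
    · intro l hl
      simp only [List.mem_append, List.mem_reverse, List.mem_cons] at hl
      rcases hl with h | h | h
      · exact h1.2.1 l (by simp [h])
      · omega
      · exact h1.2.1 l (by simp [h])
    · simp [Phi, rl_append, rl_cons, rl_rl, rb]
    · have := size_rl M
      simp only [Phi, size_append]
      simp only [size, List.map_cons, List.sum_cons, bs] at *
      simp at h2 ⊢
      omega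

theorem Phi_surj (n : ℕ) (L) (hL : Good L) (hr : rl L = L) (hs : size L = 2 * n) :
    ∃ x ∈ T n, Phi x = L := by
  rcases pal rb L hr with ⟨M, rfl⟩ | ⟨M, b, hb, rfl⟩
  · change Good (M ++ rl M) at hL
    change size (M ++ rl M) = _ at hs
    rw [size_append, size_rl] at hs
    exact ⟨(M, []), ⟨(good_even M).1 hL, by simp; omega⟩, rfl⟩
  · change Good (M ++ b :: rl M) at hL
    change size (M ++ b :: rl M) = _ at hs
    have hz := size_rl M
    rw [size_append] at hs
    simp only [size, List.map_cons, List.sum_cons] at hs hz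
    cases b with
    | none => simp only [bs] at hs; omega
    | some c =>
      rw [good_mid, good_snoc] at hL
      have hb' : c.reverse = c := by simpa [rb] using hb
      simp only [bs] at hs
      rcases pal id c (by simpa using hb') with ⟨d, rfl⟩ | ⟨d, k, -, rfl⟩
      · simp at hs; omega
      · simp at hs
        obtain ⟨hp, hc, hh⟩ := hL
        have hk : 0 < k := hc k (by simp)
        have : 2 * ((k + 1) / 2) - 1 = k := by omega
        refine ⟨(M, (k + 1) / 2 :: d.reverse), ⟨(good_snoc _ _).2 ⟨hp, ?_, hh⟩, ?_⟩, ?_⟩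
        · intro l hl
          simp only [List.mem_cons, List.mem_reverse] at hl
          rcases hl with h | h
          · omega
          · exact hc l (by simp [h])
        · simp [size]; omega
        · simp [Phi, this, rl]

theorem Phi_inj (n : ℕ) : Set.InjOn Phi (T n) := by
  rintro ⟨M, c⟩ hx ⟨M', c'⟩ hy h
  have hc := ((good_snoc _ _).1 hx.1).2.1
  have hc' := ((good_snoc _ _).1 hy.1).2.1
  have hl := congrArg List.length h
  cases c with
  | nil => cases c' with
    | nil =>
      simp [Phi, rl] at hl
      have := List.append_inj h (by omega)
      simp [this.1]
    | cons l c' => simp [Phi, rl] at hl; omega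
  | cons k c => cases c' with
    | nil => simp [Phi, rl] at hl; omega
    | cons l c' =>
      simp [Phi, rl] at hl
      have := List.append_inj h (by omega)
      have h2 := this.2
      simp only [List.cons.injEq, Option.some.injEq] at h2
      have h3 := h2.1
      have hl' := congrArg List.length h3
      simp at hl'
      have h4 := (List.append_inj h3 (by simp; omega)).2
      simp only [List.cons.injEq] at h4
      have := hc k (by simp)
      have := hc' l (by simp)
      have : k = l := by omega
      simp_all

def ff (x : List (Option (List ℕ)) × List ℕ) : List Step := flat x.1 ++ Step.N :: peaks x.2

theorem ff_snoc (x) : ff x ++ [Step.E] = flat (x.1 ++ [some x.2]) := by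
  simp [ff, flat_append, flat]

theorem ff_inj (n : ℕ) : Set.InjOn ff (T n) := by
  rintro ⟨M, c⟩ hx ⟨M', c'⟩ hy h
  have h2 : ff (M, c) ++ [Step.E] = ff (M', c') ++ [Step.E] := by rw [h]
  rw [ff_snoc, ff_snoc] at h2
  have := flat_inj _ _ hx.1.1 hy.1.1 h2
  have := List.append_inj' this rfl
  simpa using this

theorem memD_flat (L) (hL : PosL L) : MemD (size L) (flat L) :=
  ⟨dword_flat L hL, fun q hq => by simpa using sp_prefix _ _ (sp_flat L) q hq, pos_flat L⟩

theorem ff_image (n : ℕ) : ff '' T n =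
    {p : List Step | MemCalD p ∧ Featureless p ∧ posX p + 1 = n + 1 ∧ posY p = n + 1} := by
  ext p
  constructor
  · rintro ⟨⟨M, c⟩, ⟨h1, h2⟩, rfl⟩
    simp only at h1 h2
    refine ⟨⟨_, _, ?_, memD_flat _ h1.1⟩, ?_, ?_, ?_⟩
    · exact ⟨_, ff_snoc (M, c)⟩
    · rw [featureless_iff, ← ok_snocE, ff_snoc, ok_flat]
      exact h1.2
    · simp [ff, pos_flat, pos_peaks]; omega
    · simp [ff, pos_flat, pos_peaks]; omega
  · rintro ⟨⟨m, q, hpq, hq⟩, hf, hx, hy⟩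
    have hd := dword_pre hq.1 p hpq (by omega)
    rw [featureless_iff, ← ok_snocE] at hf
    obtain ⟨L, hL, e⟩ := dword_ok hd hf
    rcases List.eq_nil_or_concat L with rfl | ⟨M, b, rfl⟩
    · simp [flat] at e
    · rw [List.concat_eq_append] at e hL
      cases b with
      | none =>
        rw [flat_append] at e
        have := (List.append_inj' e rfl).2
        simp [flat] at this
      | some c =>
        rw [← ff_snoc (M, c)] at e
        have := (List.append_inj' e rfl).1
        refine ⟨(M, c), ⟨hL, ?_⟩, this.symm⟩
        rw [this] at hx
        simp [ff, pos_flat, pos_peaks] at hx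
        exact hx

theorem gg_inj (n : ℕ) : Set.InjOn (fun x => flat (Phi x)) (T n) := by
  intro x hx y hy h
  exact Phi_inj n hx hy (flat_inj _ _ (Phi_spec n x hx).1.1 (Phi_spec n y hy).1.1 h)

theorem gg_image (n : ℕ) : (fun x => flat (Phi x)) '' T n =
    {p : List Step | MemD (2 * n) p ∧ revPath p = p ∧ Featureless p} := by
  ext p
  constructor
  · rintro ⟨x, hx, rfl⟩
    obtain ⟨h1, h2, h3⟩ := Phi_spec n x hx
    refine ⟨h3 ▸ memD_flat _ h1.1, ?_, ?_⟩
    · simp only [revPath_flat, h2]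
    · rw [featureless_iff]; exact (ok_flat _).2 h1.2
  · rintro ⟨hd, hr, hf⟩
    rw [featureless_iff] at hf
    obtain ⟨L, hL, rfl⟩ := dword_ok hd.1 hf
    rw [revPath_flat] at hr
    have hr' := flat_inj _ _ ((posL_rl L).2 hL.1) hL.1 hr
    obtain ⟨x, hx, rfl⟩ := Phi_surj n L hL hr' (by rw [← (pos_flat L).1]; exact hd.2.2.1)
    exact ⟨x, hx, rfl⟩

end S16

theorem stmt_16 :
    ∀ n : ℕ, 1 ≤ n →
      Set.ncard {p : List Step | MemD (2 * n) p ∧ revPath p = p ∧ Featureless p} =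
        dSeq (n + 1) := by
  intro n _
  rw [← S16.gg_image, dSeq, ← S16.ff_image, Set.ncard_image_of_injOn (S16.gg_inj n),
    Set.ncard_image_of_injOn (S16.ff_inj n)]
end

section
/- For every n ≥ 1, the number of Schröder paths p ∈ D_{2n−1} satisfying rev(p) = p and having no features equals the number of Schröder paths p ∈ D_{2n} satisfying rev(p) = p and having no features. -/
namespace FP
open Step

def G : ℕ → List Step → Prop
  | h, [] => h = 0
  | h, N :: r => G (h + 1) r
  | h, E :: r => ∃ k, h = k + 1 ∧ (r.head? = some N → k = 1) ∧ G k r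
  | h, D :: r => h = 0 ∧ G 0 r

def W : ℕ → List Step → Prop
  | h, [] => h = 0
  | h, N :: r => W (h + 1) r
  | h, E :: r => ∃ k, h = k + 1 ∧ (r.head? = some N → k ≤ 1) ∧ W k r
  | h, D :: r => h ≤ 1 ∧ W h r

theorem posX_append (a b : List Step) : posX (a ++ b) = posX a + posX b := by
  simp [posX]; omega
theorem posY_append (a b : List Step) : posY (a ++ b) = posY a + posY b := by
  simp [posY]; omega
@[simp] theorem posX_nil : posX [] = 0 := rfl
@[simp] theorem posY_nil : posY [] = 0 := rfl
@[simp] theorem posX_E (r : List Step) : posX (E :: r) = posX r + 1 := by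
  simp [posX]; omega
@[simp] theorem posX_N (r : List Step) : posX (N :: r) = posX r := by
  simp [posX]
@[simp] theorem posX_D (r : List Step) : posX (D :: r) = posX r + 1 := by
  simp [posX]; omega
@[simp] theorem posY_E (r : List Step) : posY (E :: r) = posY r := by
  simp [posY]
@[simp] theorem posY_N (r : List Step) : posY (N :: r) = posY r + 1 := by
  simp [posY]; omega
@[simp] theorem posY_D (r : List Step) : posY (D :: r) = posY r + 1 := by
  simp [posY]; omega

theorem G_split (q r : List Step) (h : ℕ) (hg : G h (q ++ r)) :
    ∃ k, k + posX q = h + posY q ∧ G k r := by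
  induction q generalizing h with
  | nil => exact ⟨h, by simp, hg⟩
  | cons a q ih =>
    cases a with
    | E =>
      obtain ⟨k, rfl, -, hk⟩ := hg
      obtain ⟨k', h1, h2⟩ := ih _ hk
      exact ⟨k', by simp; omega, h2⟩
    | N =>
      obtain ⟨k', h1, h2⟩ := ih _ hg
      exact ⟨k', by simp; omega, h2⟩
    | D =>
      obtain ⟨rfl, hk⟩ := hg
      obtain ⟨k', h1, h2⟩ := ih _ hk
      exact ⟨k', by simp; omega, h2⟩

theorem G_replace (x r r' : List Step) (hd : r'.head? = some N → r.head? = some N)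
    (hr : ∀ k, G k r → G k r') (h : ℕ) (hg : G h (x ++ r)) : G h (x ++ r') := by
  induction x generalizing h with
  | nil => exact hr _ hg
  | cons a x ih =>
    cases a with
    | E =>
      obtain ⟨k, rfl, h1, hk⟩ := hg
      refine ⟨k, rfl, fun h2 => h1 ?_, ih _ hk⟩
      cases x with
      | nil => exact hd h2
      | cons b x => simpa using h2
    | N => exact ih _ hg
    | D => exact ⟨hg.1, ih _ hg.2⟩

theorem G_structure (n : ℕ) : ∀ p : List Step, p.length ≤ n →
    (G 0 p → IsDWord p) ∧
    (G 1 p → ∃ q p', p = q ++ E :: p' ∧ IsInnerWord q ∧ IsDWord p') ∧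
    (∀ k, G (k + 2) p → ∃ j q p', p = List.replicate j N ++ List.replicate (j + k + 1) E ++
      (q ++ E :: p') ∧ IsInnerWord q ∧ IsDWord p') := by
  induction n with
  | zero =>
    intro p hp
    have : p = [] := by simpa using hp
    subst this
    exact ⟨fun _ => .nil, fun h => by simp [G] at h, fun k h => by simp [G] at h⟩
  | succ n ih =>
    intro p hp
    match p, hp with
    | [], _ => exact ⟨fun _ => .nil, fun h => by simp [G] at h, fun k h => by simp [G] at h⟩
    | D :: r, hp =>
      have hr : r.length ≤ n := by simpa using hp
      exact ⟨fun h => .dcons ((ih r hr).1 h.2), fun h => by simp [G] at h,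
        fun k h => by simp [G] at h⟩
    | N :: r, hp =>
      have hr : r.length ≤ n := by simpa using hp
      obtain ⟨i0, i1, i2⟩ := ih r hr
      refine ⟨fun h => ?_, fun h => ?_, fun k h => ?_⟩
      · obtain ⟨q, p', rfl, hq, hp'⟩ := i1 h
        exact .block hq hp'
      · obtain ⟨j, q, p', rfl, hq, hp'⟩ := i2 0 h
        refine ⟨List.replicate (j+1) N ++ List.replicate (j+1) E ++ q, p', ?_, .peak (by omega) hq, hp'⟩
        simp [List.replicate_succ]
      · obtain ⟨j, q, p', rfl, hq, hp'⟩ := i2 (k+1) h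
        refine ⟨j+1, q, p', ?_, hq, hp'⟩
        rw [show j + 1 + k + 1 = j + (k+1) + 1 by omega]
        simp [List.replicate_succ]
    | E :: r, hp =>
      have hr : r.length ≤ n := by simpa using hp
      obtain ⟨i0, i1, i2⟩ := ih r hr
      refine ⟨fun h => ?_, fun h => ?_, fun k h => ?_⟩
      · obtain ⟨k, h0, -⟩ := h
        omega
      · obtain ⟨k, h0, -, h1⟩ := h
        obtain rfl : k = 0 := by omega
        exact ⟨[], r, rfl, .nil, i0 h1⟩
      · obtain ⟨k', h0, hN, h1⟩ := h
        obtain rfl : k' = k + 1 := by omega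
        cases k with
        | zero =>
          obtain ⟨q, p', rfl, hq, hp'⟩ := i1 h1
          exact ⟨0, q, p', by simp, hq, hp'⟩
        | succ k =>
          obtain ⟨j, q, p', rfl, hq, hp'⟩ := i2 k h1
          cases j with
          | zero => exact ⟨0, q, p', by simp [List.replicate_succ], hq, hp'⟩
          | succ j =>
            exfalso
            have := hN (by simp [List.replicate_succ])
            omega

theorem W_E (k : ℕ) (q : List Step) (hq : W 1 q) : W (1 + k) (List.replicate k E ++ q) := by
  induction k with
  | zero => simpa using hq
  | succ k ih =>
    rw [List.replicate_succ, List.cons_append]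
    refine ⟨1 + k, by omega, ?_, ih⟩
    cases k with
    | zero => simp
    | succ k => simp [List.replicate_succ]

theorem W_N (k h : ℕ) (q : List Step) (hq : W (h + k) q) : W h (List.replicate k N ++ q) := by
  induction k generalizing h with
  | zero => simpa using hq
  | succ k ih =>
    rw [List.replicate_succ, List.cons_append]
    exact ih (h+1) (by rwa [show h + 1 + k = h + (k+1) by omega])

theorem W_inner (q p : List Step) (hq : IsInnerWord q) (hp : W 0 p) : W 1 (q ++ E :: p) := by
  induction hq with
  | nil => exact ⟨0, rfl, by simp, hp⟩
  | dcons _ ih => exact ⟨le_rfl, ih⟩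
  | @peak k q hk _ ih =>
    rw [List.append_assoc, List.append_assoc]
    exact W_N _ _ _ (W_E _ _ ih)

theorem W_D (p : List Step) (hp : IsDWord p) : W 0 p := by
  induction hp with
  | nil => rfl
  | dcons _ ih => exact ⟨by omega, ih⟩
  | block hq _ ih => exact W_inner _ _ hq ih

theorem G_of_W (p s : List Step) (h : ℕ) (hs : posY s = posX s + h) (hw : W h p)
    (hf : Featureless (s ++ p)) : G h p := by
  induction p generalizing s h with
  | nil => exact hw
  | cons a p ih =>
    have e : s ++ a :: p = (s ++ [a]) ++ p := by simp
    cases a with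
    | N =>
      exact ih (s ++ [N]) (h+1) (by simp [posX_append, posY_append]; omega) hw (e ▸ hf)
    | D =>
      obtain ⟨h1, h2⟩ := hw
      have h0 : h = 0 := by
        by_contra hne
        exact (hf (posY s)).1 ⟨by omega, s, p, rfl, by omega, rfl⟩
      subst h0
      exact ⟨rfl, ih (s ++ [D]) 0 (by simp [posX_append, posY_append]; omega) h2 (e ▸ hf)⟩
    | E =>
      obtain ⟨k, rfl, h1, h2⟩ := hw
      refine ⟨k, rfl, fun hN => ?_, ih (s ++ [E]) k (by simp [posX_append, posY_append]; omega) h2 (e ▸ hf)⟩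
      have := h1 hN
      by_contra hne
      match p, hN with
      | N :: r, _ =>
        exact (hf (posY s)).2 ⟨by omega, s, r, rfl, by omega, rfl⟩

theorem char (n : ℕ) (p : List Step) :
    (MemD n p ∧ Featureless p) ↔ (G 0 p ∧ posX p = n) := by
  constructor
  · rintro ⟨⟨h1, h2⟩, h3⟩
    exact ⟨G_of_W p [] 0 rfl (W_D p h1) h3, h2.2.1⟩
  · rintro ⟨hg, hn⟩
    refine ⟨⟨(G_structure _ p le_rfl).1 hg, ?_, hn, ?_⟩, ?_⟩
    · rintro q ⟨r, rfl⟩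
      obtain ⟨k, h1, -⟩ := G_split q r 0 hg
      omega
    · obtain ⟨k, h1, h2⟩ := G_split p [] 0 (by simpa using hg)
      have : k = 0 := h2
      omega
    · intro t
      constructor
      · rintro ⟨ht, q, r, rfl, hx, hy⟩
        obtain ⟨k, h1, h2, -⟩ := G_split q _ 0 hg
        omega
      · rintro ⟨ht, q, r, rfl, hx, hy⟩
        obtain ⟨k, h1, k', h2, h3, -⟩ := G_split q _ 0 hg
        have := h3 rfl
        omega

@[simp] theorem revPath_nil : revPath [] = [] := rfl
theorem revPath_append (a b : List Step) : revPath (a ++ b) = revPath b ++ revPath a := by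
  simp [revPath]
theorem revPath_cons (a : Step) (b : List Step) : revPath (a :: b) = revPath b ++ [revStep a] := by
  simp [revPath]
@[simp] theorem revPath_length (a : List Step) : (revPath a).length = a.length := by
  simp [revPath]
theorem revStep_revStep (a : Step) : revStep (revStep a) = a := by cases a <;> rfl
@[simp] theorem revPath_revPath (a : List Step) : revPath (revPath a) = a := by
  induction a with
  | nil => rfl
  | cons a l ih => simp [revPath_cons, revPath_append, ih, revStep_revStep]
theorem posX_rev (a : List Step) : posX (revPath a) = posY a := by
  induction a with
  | nil => rfl
  | cons a l ih => cases a <;> simp [revPath_cons, posX_append, ih, revStep]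

theorem pal (p : List Step) : revPath p = p →
    ∃ x, p = x ++ revPath x ∨ p = x ++ D :: revPath x := by
  induction p using List.bidirectionalRec with
  | nil => exact fun _ => ⟨[], Or.inl rfl⟩
  | singleton a =>
    intro h
    refine ⟨[], Or.inr ?_⟩
    cases a <;> simp [revPath, revStep] at h ⊢
  | cons_append a l b ih =>
    intro h
    simp only [revPath_cons, revPath_append, revPath_nil, List.nil_append, List.cons_append,
      List.cons.injEq] at h
    obtain ⟨h1, h2⟩ := h
    obtain ⟨h3, h4⟩ := List.append_inj h2 (by simp)
    obtain rfl : revStep a = b := by simpa using h4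
    obtain ⟨x, hx | hx⟩ := ih h3
    · exact ⟨a :: x, Or.inl (by rw [hx]; simp [revPath_cons])⟩
    · exact ⟨a :: x, Or.inr (by rw [hx]; simp [revPath_cons])⟩

def SA (n : ℕ) : Set (List Step) := {p | G 0 p ∧ posX p = n ∧ revPath p = p}

theorem SA_odd (n : ℕ) (p : List Step) (hp : p ∈ SA (2 * n + 1)) :
    ∃ y, p = y ++ D :: revPath y ∨ p = y ++ N :: E :: revPath y ∨ p = y ++ E :: N :: revPath y := by
  obtain ⟨hg, hx, hr⟩ := hp
  obtain ⟨x, rfl | rfl⟩ := pal p hr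
  · rcases List.eq_nil_or_concat x with rfl | ⟨y, a, rfl⟩
    · simp at hx
    · refine ⟨y, ?_⟩
      cases a with
      | E => right; right; simp [revPath_append, revPath_cons, revStep]
      | N => right; left; simp [revPath_append, revPath_cons, revStep]
      | D =>
        exfalso
        have e : y ++ [D] ++ revPath (y ++ [D]) = y ++ D :: D :: revPath y := by
          simp [revPath_append, revPath_cons, revStep]
        simp only [List.concat_eq_append] at *
        rw [e] at hg hx
        obtain ⟨k, h1, h2, -⟩ := G_split y _ 0 hg
        simp [posX_append, posX_rev] at hx
        omega
  · exact ⟨x, Or.inl rfl⟩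

theorem SA_even (n : ℕ) (p : List Step) (hp : p ∈ SA (2 * n + 2)) :
    ∃ y, p = y ++ D :: D :: revPath y ∨ p = y ++ N :: N :: E :: E :: revPath y ∨
      p = y ++ E :: N :: E :: N :: revPath y := by
  obtain ⟨hg, hx, hr⟩ := hp
  obtain ⟨x, rfl | rfl⟩ := pal p hr
  · rcases List.eq_nil_or_concat x with rfl | ⟨y, a, rfl⟩
    · simp at hx
    · simp only [List.concat_eq_append] at *
      cases a with
      | E =>
        exfalso
        have e : y ++ [E] ++ revPath (y ++ [E]) = y ++ E :: N :: revPath y := by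
          simp [revPath_append, revPath_cons, revStep]
        rw [e] at hg hx
        obtain ⟨k, h1, k', h2, h3, -⟩ := G_split y _ 0 hg
        have := h3 rfl
        simp [posX_append, posX_rev] at hx
        omega
      | D => exact ⟨y, Or.inl (by simp [revPath_append, revPath_cons, revStep])⟩
      | N =>
        rcases List.eq_nil_or_concat y with rfl | ⟨z, b, rfl⟩
        · simp [revPath_cons, revStep] at hx
        · simp only [List.concat_eq_append] at *
          refine ⟨z, ?_⟩
          cases b with
          | E => right; right; simp [revPath_append, revPath_cons, revStep]
          | N => right; left; simp [revPath_append, revPath_cons, revStep]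
          | D =>
            exfalso
            have e : z ++ [D] ++ [N] ++ revPath (z ++ [D] ++ [N]) =
                z ++ D :: N :: E :: D :: revPath z := by
              simp [revPath_append, revPath_cons, revStep]
            rw [e] at hg hx
            obtain ⟨k, h1, h2, -⟩ := G_split z _ 0 hg
            simp [posX_append, posX_rev] at hx
            omega
  · exfalso
    obtain ⟨k, h1, h2, -⟩ := G_split x _ 0 hg
    simp [posX_append, posX_rev] at hx
    omega

theorem rD (k : ℕ) (s : List Step) : G k (D :: s) ↔ G k (D :: D :: s) := by
  simp [G]
theorem rN (k : ℕ) (s : List Step) : G k (N :: E :: s) ↔ G k (N :: N :: E :: E :: s) := by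
  simp [G]
theorem rE (k : ℕ) (s : List Step) : G k (E :: N :: s) ↔ G k (E :: N :: E :: N :: s) := by
  simp [G]

def f (p : List Step) : List Step :=
  p.take (p.length / 2) ++ ((if p.length % 2 = 0 then [N, E] else [D]) ++ p.drop (p.length / 2))

theorem f_even (x : List Step) : f (x ++ revPath x) = (x ++ [N]) ++ revPath (x ++ [N]) := by
  have : (x.length + x.length) / 2 = x.length := by omega
  have h2 : (x.length + x.length) % 2 = 0 := by omega
  simp [f, this, h2, revPath_append, revPath_cons, revStep]

theorem f_odd (x : List Step) : f (x ++ D :: revPath x) = (x ++ [D]) ++ revPath (x ++ [D]) := by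
  have : (x.length + (x.length + 1)) / 2 = x.length := by omega
  have h2 : (x.length + (x.length + 1)) % 2 = 1 := by omega
  simp [f, this, h2, revPath_append, revPath_cons, revStep]

theorem half_inj (a b : List Step) (h : a ++ revPath a = b ++ revPath b) : a = b := by
  have hl := congrArg List.length h
  simp at hl
  exact (List.append_inj h (by omega)).1

theorem fD (y : List Step) : f (y ++ D :: revPath y) = y ++ D :: D :: revPath y := by
  rw [f_odd]; simp [revPath_append, revPath_cons, revStep]
theorem fN (y : List Step) :
    f (y ++ N :: E :: revPath y) = y ++ N :: N :: E :: E :: revPath y := by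
  have := f_even (y ++ [N])
  simpa [revPath_append, revPath_cons, revStep] using this
theorem fE (y : List Step) :
    f (y ++ E :: N :: revPath y) = y ++ E :: N :: E :: N :: revPath y := by
  have := f_even (y ++ [E])
  simpa [revPath_append, revPath_cons, revStep] using this

theorem main (n : ℕ) : (SA (2 * n + 1)).ncard = (SA (2 * n + 2)).ncard := by
  refine Set.ncard_congr (fun p _ => f p) ?_ ?_ ?_
  · intro p hp
    obtain ⟨y, rfl | rfl | rfl⟩ := SA_odd n p hp
    · obtain ⟨hg, hx, hr⟩ := hp
      rw [fD]
      refine ⟨G_replace _ _ _ (by simp) (fun k => (rD k _).1) _ hg, ?_, ?_⟩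
      · simp [posX_append] at hx ⊢; omega
      · simp [revPath_append, revPath_cons, revStep]
    · obtain ⟨hg, hx, hr⟩ := hp
      rw [fN]
      refine ⟨G_replace _ _ _ (by simp) (fun k => (rN k _).1) _ hg, ?_, ?_⟩
      · simp [posX_append] at hx ⊢; omega
      · simp [revPath_append, revPath_cons, revStep]
    · obtain ⟨hg, hx, hr⟩ := hp
      rw [fE]
      refine ⟨G_replace _ _ _ (by simp) (fun k => (rE k _).1) _ hg, ?_, ?_⟩
      · simp [posX_append] at hx ⊢; omega
      · simp [revPath_append, revPath_cons, revStep]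
  · intro p p' hp hp' h
    obtain ⟨x, rfl | rfl⟩ := pal p hp.2.2 <;> obtain ⟨x', rfl | rfl⟩ := pal p' hp'.2.2 <;>
      simp only [f_even, f_odd] at h <;> have h2 := half_inj _ _ h <;> simp at h2
    · rw [h2]
    · rw [h2]
  · intro p hp
    obtain ⟨y, rfl | rfl | rfl⟩ := SA_even n p hp
    · obtain ⟨hg, hx, hr⟩ := hp
      refine ⟨_, ⟨G_replace _ _ _ (by simp) (fun k => (rD k _).2) _ hg, ?_, ?_⟩, fD y⟩
      · simp [posX_append] at hx ⊢; omega
      · simp [revPath_append, revPath_cons, revStep]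
    · obtain ⟨hg, hx, hr⟩ := hp
      refine ⟨_, ⟨G_replace _ _ _ (by simp) (fun k => (rN k _).2) _ hg, ?_, ?_⟩, fN y⟩
      · simp [posX_append] at hx ⊢; omega
      · simp [revPath_append, revPath_cons, revStep]
    · obtain ⟨hg, hx, hr⟩ := hp
      refine ⟨_, ⟨G_replace _ _ _ (by simp) (fun k => (rE k _).2) _ hg, ?_, ?_⟩, fE y⟩
      · simp [posX_append] at hx ⊢; omega
      · simp [revPath_append, revPath_cons, revStep]

theorem set_eq (n : ℕ) : {p : List Step | MemD n p ∧ revPath p = p ∧ Featureless p} = SA n := by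
  ext p
  have := char n p
  simp only [SA, Set.mem_setOf_eq]
  tauto

end FP

theorem stmt_17 :
    ∀ n : ℕ, 1 ≤ n →
      Set.ncard {p : List Step | MemD (2 * n - 1) p ∧ revPath p = p ∧ Featureless p} =
        Set.ncard {p : List Step | MemD (2 * n) p ∧ revPath p = p ∧ Featureless p} := by
  intro n hn
  obtain ⟨m, rfl⟩ : ∃ m, n = m + 1 := ⟨n - 1, by omega⟩
  rw [FP.set_eq, FP.set_eq, show 2 * (m + 1) - 1 = 2 * m + 1 by omega,
    show 2 * (m + 1) = 2 * m + 2 by omega]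
  exact FP.main m
end

section
/- Let f(m) denote the number of centrosymmetric permutations of {1,2,…,m} that avoid both of the patterns 1243 and 2143. Then f(2n) = f(2n+1) for all n ≥ 1; moreover f(2) = 2, f(4) = 7, and f(2n) + f(2n−4) = 4 f(2n−2) for all n ≥ 3. (That is, |C_{2n}(1243,2143)| = |C_{2n+1}(1243,2143)| = q_n where q_1 = 2, q_2 = 7 and q_n = 4 q_{n−1} − q_{n−2} for n ≥ 3.) -/
/-- `f m`: the number of centrosymmetric permutations of `{1, …, m}` avoiding
both `1243` and `2143`. -/
noncomputable def f (m : ℕ) : ℕ :=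
  Set.ncard {π : Equiv.Perm (Fin m) | rc π = π ∧ Avoids π pat1243 ∧ Avoids π pat2143}

/-! ### Auxiliary development -/

namespace Aux18

def Bad {M : ℕ} (π : Equiv.Perm (Fin M)) (i j k l : Fin M) : Prop :=
  i < j ∧ j < k ∧ k < l ∧ π i < π l ∧ π j < π l ∧ π l < π k

def Sym {M : ℕ} (π : Equiv.Perm (Fin M)) : Prop := ∀ i, π (Fin.rev i) = Fin.rev (π i)

def Good {M : ℕ} (π : Equiv.Perm (Fin M)) : Prop :=
  Sym π ∧ ∀ i j k l, ¬ Bad π i j k l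

theorem rc_iff {M : ℕ} (π : Equiv.Perm (Fin M)) : rc π = π ↔ Sym π := by
  constructor
  · intro h i
    have := congrArg (fun e : Equiv.Perm (Fin M) => e i) h
    simp only [rc, Equiv.trans_apply, Fin.revPerm_apply] at this
    rw [← this, Fin.rev_rev]
  · intro h
    ext i
    simp only [rc, Equiv.trans_apply, Fin.revPerm_apply]
    rw [h i, Fin.rev_rev]

theorem strictMono4 {M : ℕ} {i j k l : Fin M} (h1 : i < j) (h2 : j < k) (h3 : k < l) :
    StrictMono ![i, j, k, l] := by
  rw [Fin.strictMono_iff_lt_succ]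
  intro a
  fin_cases a <;> simpa

theorem avoid_iff {M : ℕ} (π : Equiv.Perm (Fin M)) :
    (Avoids π pat1243 ∧ Avoids π pat2143) ↔ ∀ i j k l, ¬ Bad π i j k l := by
  constructor
  · rintro ⟨h1, h2⟩ i j k l ⟨hij, hjk, hkl, a, b, c⟩
    have hne : π i ≠ π j := fun h => hij.ne (π.injective h)
    rcases lt_or_gt_of_ne hne with h | h
    · apply h1
      refine ⟨![i, j, k, l], strictMono4 hij hjk hkl, ?_⟩
      intro x y
      fin_cases x <;> fin_cases y <;> simp [pat1243, Equiv.swap_apply_def] <;> omega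
    · apply h2
      refine ⟨![i, j, k, l], strictMono4 hij hjk hkl, ?_⟩
      intro x y
      fin_cases x <;> fin_cases y <;> simp [pat2143, Equiv.swap_apply_def] <;> omega
  · intro h
    constructor
    · rintro ⟨g, hg, hh⟩
      exact h (g 0) (g 1) (g 2) (g 3) ⟨hg (by decide), hg (by decide), hg (by decide),
        (hh 0 3).1 (by decide), (hh 1 3).1 (by decide), (hh 3 2).1 (by decide)⟩
    · rintro ⟨g, hg, hh⟩
      exact h (g 0) (g 1) (g 2) (g 3) ⟨hg (by decide), hg (by decide), hg (by decide),
        (hh 0 3).1 (by decide), (hh 1 3).1 (by decide), (hh 3 2).1 (by decide)⟩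

theorem f_eq (M : ℕ) : f M = Set.ncard {π : Equiv.Perm (Fin M) | Good π} := by
  unfold f
  congr 1
  ext π
  simp only [Set.mem_setOf_eq, rc_iff, avoid_iff, Good]

/-- dual pattern -/
theorem Good.dual {M : ℕ} {π : Equiv.Perm (Fin M)} (h : Good π) {i j k l : Fin M}
    (hij : i < j) (hjk : j < k) (hkl : k < l) (a : π j < π i) (b : π i < π k) (c : π i < π l) :
    False := by
  obtain ⟨hs, hb⟩ := h
  refine hb (Fin.rev l) (Fin.rev k) (Fin.rev j) (Fin.rev i) ⟨?_, ?_, ?_, ?_, ?_, ?_⟩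
  all_goals simp only [hs _, Fin.rev_lt_rev]; assumption

structure Sys (m M : ℕ) where
  e : Fin m → Fin M
  p : Fin M
  mono : StrictMono e
  e_rev : ∀ j, e (Fin.rev j) = Fin.rev (e j)
  cover : ∀ x, x = p ∨ x = Fin.rev p ∨ ∃ j, e j = x
  ne : ∀ j, e j ≠ p

variable {m M : ℕ}

theorem Sys.ne' (s : Sys m M) (j) : s.e j ≠ Fin.rev s.p := by
  intro h
  apply s.ne (Fin.rev j)
  rw [s.e_rev, h, Fin.rev_rev]

def Rel (s t : Sys m M) (σ : Equiv.Perm (Fin m)) (π : Equiv.Perm (Fin M)) : Prop :=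
  π s.p = t.p ∧ π (Fin.rev s.p) = Fin.rev t.p ∧ ∀ j, π (s.e j) = t.e (σ j)

theorem Rel.uniq_right {s t : Sys m M} {σ π π'} (h : Rel s t σ π) (h' : Rel s t σ π') :
    π = π' := by
  ext x
  rcases s.cover x with rfl | rfl | ⟨j, rfl⟩
  · rw [h.1, h'.1]
  · rw [h.2.1, h'.2.1]
  · rw [h.2.2, h'.2.2]

theorem Rel.uniq_left {s t : Sys m M} {σ σ' π} (h : Rel s t σ π) (h' : Rel s t σ' π) :
    σ = σ' := by
  ext j
  have : t.e (σ j) = t.e (σ' j) := by rw [← h.2.2, ← h'.2.2]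
  rw [t.mono.injective this]

theorem exists_ins (s t : Sys m M) (hst : s.p = Fin.rev s.p ↔ t.p = Fin.rev t.p)
    (σ : Equiv.Perm (Fin m)) : ∃ π, Rel s t σ π := by
  classical
  let g : Fin M → Fin M := fun x =>
    if x = s.p then t.p else if x = Fin.rev s.p then Fin.rev t.p
    else if h : ∃ j, s.e j = x then t.e (σ h.choose) else x
  have g1 : g s.p = t.p := by simp [g]
  have g2 : g (Fin.rev s.p) = Fin.rev t.p := by
    by_cases h : s.p = Fin.rev s.p
    · rw [← h, g1]; exact hst.1 h
    · simp only [g]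
      rw [if_neg (fun h' => h h'.symm)]
      simp
  have g3 : ∀ j, g (s.e j) = t.e (σ j) := by
    intro j
    have hex : ∃ j', s.e j' = s.e j := ⟨j, rfl⟩
    simp only [g]
    rw [if_neg (s.ne j), if_neg (s.ne' j), dif_pos hex]
    rw [s.mono.injective hex.choose_spec]
  have ginj : Function.Injective g := by
    intro x y hxy
    rcases s.cover x with rfl | rfl | ⟨j, rfl⟩ <;> rcases s.cover y with rfl | rfl | ⟨j', rfl⟩
    · rfl
    · rw [g1, g2] at hxy; exact hst.2 hxy
    · rw [g1, g3] at hxy; exact absurd hxy.symm (t.ne _)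
    · rw [g1, g2] at hxy; exact (hst.2 hxy.symm).symm
    · rfl
    · rw [g2, g3] at hxy; exact absurd hxy.symm (t.ne' _)
    · rw [g1, g3] at hxy; exact absurd hxy (t.ne _)
    · rw [g2, g3] at hxy; exact absurd hxy (t.ne' _)
    · rw [g3, g3] at hxy
      rw [σ.injective (t.mono.injective hxy)]
  exact ⟨Equiv.ofBijective g (Finite.injective_iff_bijective.1 ginj), g1, g2, g3⟩

theorem exists_del (s t : Sys m M) (π : Equiv.Perm (Fin M)) (h1 : π s.p = t.p) (hs : Sym π) :
    ∃ σ, Rel s t σ π := by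
  have h2 : π (Fin.rev s.p) = Fin.rev t.p := by rw [hs, h1]
  have key : ∀ j, ∃ i, t.e i = π (s.e j) := by
    intro j
    rcases t.cover (π (s.e j)) with h | h | h
    · rw [← h1] at h; exact absurd (π.injective h) (s.ne _)
    · rw [← h2] at h; exact absurd (π.injective h) (s.ne' _)
    · exact h
  choose g hg using key
  have ginj : Function.Injective g := by
    intro x y hxy
    have : π (s.e x) = π (s.e y) := by rw [← hg, ← hg, hxy]
    exact s.mono.injective (π.injective this)
  exact ⟨Equiv.ofBijective g (Finite.injective_iff_bijective.1 ginj), h1, h2,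
    fun j => (hg j).symm⟩

theorem Rel.sym_iff {s t : Sys m M} {σ π} (h : Rel s t σ π) : Sym π ↔ Sym σ := by
  constructor
  · intro hs j
    apply t.mono.injective
    rw [← h.2.2, s.e_rev, hs, h.2.2, t.e_rev]
  · intro hs x
    rcases s.cover x with rfl | rfl | ⟨j, rfl⟩
    · rw [h.1, h.2.1]
    · rw [h.2.1, Fin.rev_rev, Fin.rev_rev, h.1]
    · rw [← s.e_rev, h.2.2, h.2.2, hs, t.e_rev]

theorem Rel.good {s t : Sys m M} {σ π} (h : Rel s t σ π) (hg : Good π) : Good σ := by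
  refine ⟨h.sym_iff.1 hg.1, ?_⟩
  rintro i j k l ⟨a, b, c, d, e, g⟩
  refine hg.2 (s.e i) (s.e j) (s.e k) (s.e l) ⟨s.mono a, s.mono b, s.mono c, ?_, ?_, ?_⟩
  all_goals rw [h.2.2, h.2.2]; apply t.mono; assumption

theorem Rel.off {s t : Sys m M} {σ π} (h : Rel s t σ π) (hg : Good σ) :
    ∀ i j k l, (∀ x ∈ [i, j, k, l], x ≠ s.p ∧ x ≠ Fin.rev s.p) → ¬ Bad π i j k l := by
  intro i j k l hx
  have key : ∀ x ∈ [i, j, k, l], ∃ y, s.e y = x := by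
    intro x hx'
    rcases s.cover x with h | h | h
    · exact absurd h (hx x hx').1
    · exact absurd h (hx x hx').2
    · exact h
  obtain ⟨i, rfl⟩ := key i (by simp)
  obtain ⟨j, rfl⟩ := key j (by simp)
  obtain ⟨k, rfl⟩ := key k (by simp)
  obtain ⟨l, rfl⟩ := key l (by simp)
  rintro ⟨a, b, c, d, e, g⟩
  simp only [h.2.2] at d e g
  simp only [s.mono.lt_iff_lt, t.mono.lt_iff_lt] at a b c d e g
  exact hg.2 i j k l ⟨a, b, c, d, e, g⟩

theorem ncard_rel {α β : Type*} {A : Set α} {B : Set β} (R : α → β → Prop)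
    (h1 : ∀ a ∈ A, ∃ b ∈ B, R a b) (h2 : ∀ b ∈ B, ∃ a ∈ A, R a b)
    (h3 : ∀ a ∈ A, ∀ b ∈ B, ∀ b' ∈ B, R a b → R a b' → b = b')
    (h4 : ∀ a ∈ A, ∀ a' ∈ A, ∀ b ∈ B, R a b → R a' b → a = a') : A.ncard = B.ncard := by
  choose F hF hF' using h1
  refine Set.ncard_congr F hF ?_ ?_
  · intro a b ha hb hab
    exact h4 a ha b hb _ (hF a ha) (hF' a ha) (hab ▸ hF' b hb)
  · intro b hb
    obtain ⟨a, ha, hab⟩ := h2 b hb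
    exact ⟨a, ha, h3 a ha _ (hF a ha) _ hb (hF' a ha) hab⟩

theorem ncard_sys (s t : Sys m M) (hst : s.p = Fin.rev s.p ↔ t.p = Fin.rev t.p)
    (Q : Equiv.Perm (Fin m) → Prop) (Q' : Equiv.Perm (Fin M) → Prop)
    (hQ : ∀ σ π, Rel s t σ π → (Q σ ↔ Q' π))
    (hG : ∀ σ π, Rel s t σ π → Good σ → Sym π → Good π) :
    Set.ncard {σ | Good σ ∧ Q σ} = Set.ncard {π | Good π ∧ (π s.p = t.p ∧ Q' π)} := by
  apply ncard_rel (Rel s t)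
  · rintro σ ⟨h1, h2⟩
    obtain ⟨π, hπ⟩ := exists_ins s t hst σ
    exact ⟨π, ⟨hG σ π hπ h1 (hπ.sym_iff.2 h1.1), hπ.1, (hQ _ _ hπ).1 h2⟩, hπ⟩
  · rintro π ⟨h1, h2, h3⟩
    obtain ⟨σ, hσ⟩ := exists_del s t π h2 h1.1
    exact ⟨σ, ⟨hσ.good h1, (hQ _ _ hσ).2 h3⟩, hσ⟩
  · intro a _ b _ b' _ h h'
    exact h.uniq_right h'
  · intro a _ b _ b' _ h h'
    exact h.uniq_left h'

/-! the two systems -/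

def cSys (n : ℕ) : Sys (2 * n) (2 * n + 1) where
  e j := ⟨if j.val < n then j.val else j.val + 1, by split_ifs <;> omega⟩
  p := ⟨n, by omega⟩
  mono := by
    intro a b h
    simp only [Fin.lt_def] at h ⊢
    split_ifs <;> omega
  e_rev := by
    intro j
    ext
    simp only [Fin.val_rev]
    split_ifs <;> omega
  cover := by
    intro x
    by_cases h : x.val < n
    · exact Or.inr (Or.inr ⟨⟨x.val, by omega⟩, by ext; simp [h]⟩)
    · by_cases h' : x.val = n
      · left; ext; exact h'
      · refine Or.inr (Or.inr ⟨⟨x.val - 1, by omega⟩, ?_⟩)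
        ext; simp only []; split_ifs <;> omega
  ne := by
    intro j h
    have := congrArg Fin.val h
    simp only [] at this
    split_ifs at this <;> omega

def eVal (n p j : ℕ) : ℕ :=
  if j < p ∧ j < 2 * n + 1 - p then j
  else if j + 1 < p ∨ j + 1 < 2 * n + 1 - p then j + 1 else j + 2

def pSys (n : ℕ) (p : Fin (2 * n + 2)) : Sys (2 * n) (2 * n + 2) where
  e j := ⟨eVal n p.val j.val, by unfold eVal; split_ifs <;> omega⟩
  p := p
  mono := by
    intro a b h
    simp only [Fin.lt_def, eVal] at h ⊢
    split_ifs <;> omega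
  e_rev := by
    intro j
    ext
    simp only [Fin.val_rev, eVal]
    split_ifs <;> omega
  cover := by
    intro x
    by_cases h1 : x = p
    · exact Or.inl h1
    by_cases h2 : x = Fin.rev p
    · exact Or.inr (Or.inl h2)
    right; right
    have h1' : x.val ≠ p.val := fun h => h1 (Fin.ext h)
    have h2' : x.val ≠ 2 * n + 1 - p.val := fun h => h2 (Fin.ext (by simp only [Fin.val_rev]; omega))
    by_cases h : x.val < p ∧ x.val < 2 * n + 1 - p
    · exact ⟨⟨x.val, by omega⟩, by ext; simp only [eVal]; split_ifs <;> omega⟩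
    · by_cases h' : x.val < p ∨ x.val < 2 * n + 1 - p
      · exact ⟨⟨x.val - 1, by omega⟩, by ext; simp only [eVal]; split_ifs <;> omega⟩
      · exact ⟨⟨x.val - 2, by omega⟩, by ext; simp only [eVal]; split_ifs <;> omega⟩
  ne := by
    intro j h
    have := congrArg Fin.val h
    simp only [eVal] at this
    split_ifs at this <;> omega

theorem pSys_st (n : ℕ) (p v : Fin (2 * n + 2)) :
    (pSys n p).p = Fin.rev (pSys n p).p ↔ (pSys n v).p = Fin.rev (pSys n v).p := by
  simp only [pSys, Fin.ext_iff, Fin.val_rev]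
  omega

/-- index -/
abbrev ix {M : ℕ} (i : ℕ) (h : i < M := by omega) : Fin M := ⟨i, h⟩

theorem perm_inj {M : ℕ} (π : Equiv.Perm (Fin M)) {a b : Fin M} (h : (π a).val = (π b).val) :
    a.val = b.val := by
  have := π.injective (Fin.ext h)
  rw [this]

end Aux18

namespace Aux18

theorem Rel.good_of {m M : ℕ} {s t : Sys m M} {σ π} (h : Rel s t σ π) (hg : Good σ) (hs : Sym π)
    (H : ∀ i j k l, Bad π i j k l → ∀ x ∈ [i, j, k, l], x ≠ s.p ∧ x ≠ Fin.rev s.p) : Good π :=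
  ⟨hs, fun i j k l hb => h.off hg i j k l (H i j k l hb) hb⟩

theorem val_ne {M : ℕ} (π : Equiv.Perm (Fin M)) {a b : Fin M} (h : a.val < b.val) :
    (π a).val ≠ (π b).val := fun h' => by have := perm_inj π h'; omega

/-- The four easy insertions. -/
theorem easy (n : ℕ) (p v : ℕ) (hp : p < 2 * n + 2) (hv : v < 2 * n + 2)
    (hpv : (p = 0 ∧ (v = 2 * n + 1 ∨ v = 2 * n)) ∨ (p = 1 ∧ (v = 2 * n + 1 ∨ v = 2 * n)))
    (hn : 1 ≤ n)
    (σ π) (h : Rel (pSys n (ix p)) (pSys n (ix v)) σ π) (hg : Good σ) (hs : Sym π) : Good π := by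
  apply h.good_of hg hs
  rintro i j k l ⟨hij, hjk, hkl, a, b, c⟩
  have e1 := congrArg Fin.val h.1
  have e2 := congrArg Fin.val h.2.1
  have hne := val_ne π hij
  simp only [pSys, Fin.val_rev] at e1 e2
  simp only [Fin.lt_def] at *
  have := (π k).isLt
  have := l.isLt
  intro x hx
  have hx' : (x = i ∨ x = j) ∨ x = k ∨ x = l := by simpa [or_assoc] using hx
  simp only [pSys]
  constructor
  · rintro rfl
    have hr : (ix p hp : Fin (2 * n + 2)).val = p := rfl
    rcases hx' with (rfl | rfl) | rfl | rfl <;> omega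
  · rintro rfl
    have hr : (Fin.rev (ix p hp : Fin (2 * n + 2))).val = 2 * n + 1 - p := by
      simp only [Fin.val_rev]; omega
    rcases hx' with (rfl | rfl) | rfl | rfl <;> omega

theorem count_easy (n : ℕ) (p v : ℕ) (hp : p < 2 * n + 2) (hv : v < 2 * n + 2)
    (hpv : (p = 0 ∧ (v = 2 * n + 1 ∨ v = 2 * n)) ∨ (p = 1 ∧ (v = 2 * n + 1 ∨ v = 2 * n)))
    (hn : 1 ≤ n)
    (Q : Equiv.Perm (Fin (2 * n)) → Prop) (Q' : Equiv.Perm (Fin (2 * n + 2)) → Prop)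
    (hQ : ∀ σ π, Rel (pSys n (ix p)) (pSys n (ix v)) σ π → (Q σ ↔ Q' π)) :
    Set.ncard {σ | Good σ ∧ Q σ} =
      Set.ncard {π : Equiv.Perm (Fin (2 * n + 2)) | Good π ∧ ((π (ix p)).val = v ∧ Q' π)} := by
  rw [ncard_sys (pSys n (ix p)) (pSys n (ix v)) (pSys_st _ _ _) Q Q' hQ
    (easy n p v hp hv hpv hn)]
  simp only [pSys, Fin.ext_iff]

theorem count0 (n : ℕ) (p v : ℕ) (hp : p < 2 * n + 2) (hv : v < 2 * n + 2)
    (hpv : (p = 0 ∧ (v = 2 * n + 1 ∨ v = 2 * n)) ∨ (p = 1 ∧ (v = 2 * n + 1 ∨ v = 2 * n)))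
    (hn : 1 ≤ n) :
    f (2 * n) = Set.ncard {π : Equiv.Perm (Fin (2 * n + 2)) | Good π ∧ (π (ix p)).val = v} := by
  have := count_easy n p v hp hv hpv hn (fun _ => True) (fun _ => True) (by simp)
  rw [f_eq]
  simpa using this

theorem e_val (n : ℕ) (p : Fin (2 * n + 2)) (j) : ((pSys n p).e j).val = eVal n p.val j.val := rfl

theorem rel_val {n : ℕ} {p v : Fin (2 * n + 2)} {σ π} (h : Rel (pSys n p) (pSys n v) σ π)
    (j : Fin (2 * n)) (x : Fin (2 * n + 2)) (hx : x.val = eVal n p.val j.val) :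
    (π x).val = eVal n v.val (σ j).val := by
  have : x = (pSys n p).e j := Fin.ext hx
  rw [this, h.2.2, e_val]

/-- first count of an intersection -/
theorem count23 (n : ℕ) (hn : 1 ≤ n) :
    Set.ncard {σ : Equiv.Perm (Fin (2 * n)) | Good σ ∧ (σ (ix 0)).val = 2 * n - 1} =
    Set.ncard {π : Equiv.Perm (Fin (2 * n + 2)) |
      Good π ∧ ((π (ix 0)).val = 2 * n ∧ (π (ix 1)).val = 2 * n + 1)} := by
  apply count_easy n 0 (2 * n) (by omega) (by omega) (by omega) hn
  intro σ π h
  have := rel_val h (ix 0) (ix 1) (by simp only [eVal]; split_ifs <;> omega)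
  rw [this]
  have := (σ (ix 0)).isLt
  simp only [eVal]; split_ifs <;> omega

theorem count14 (n : ℕ) (hn : 1 ≤ n) :
    Set.ncard {σ : Equiv.Perm (Fin (2 * n)) | Good σ ∧ (σ (ix 0)).val = 2 * n - 1} =
    Set.ncard {π : Equiv.Perm (Fin (2 * n + 2)) |
      Good π ∧ ((π (ix 1)).val = 2 * n ∧ (π (ix 0)).val = 2 * n + 1)} := by
  apply count_easy n 1 (2 * n) (by omega) (by omega) (by omega) hn
  intro σ π h
  have := rel_val h (ix 0) (ix 0) (by simp only [eVal]; split_ifs <;> omega)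
  rw [this]
  have := (σ (ix 0)).isLt
  simp only [eVal]; split_ifs <;> omega

def InR {n : ℕ} (π : Equiv.Perm (Fin (2 * n + 2))) : Prop :=
  Good π ∧ (π (ix 0)).val < 2 * n ∧ (π (ix 1)).val ≤ 2 * n

def InT {n : ℕ} (π : Equiv.Perm (Fin (2 * n + 2))) : Prop :=
  Good π ∧ (π (ix 0)).val < 2 * n ∧ (π (ix 1)).val < 2 * n

theorem exists_pos {M : ℕ} (π : Equiv.Perm (Fin M)) (v : ℕ) (hv : v < M) :
    ∃ x, (π x).val = v := ⟨π.symm ⟨v, hv⟩, by simp⟩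

theorem no_dual {n : ℕ} {π : Equiv.Perm (Fin (2 * n + 2))} (hg : Good π) {i j : Fin (2 * n + 2)}
    (hij : i < j) (hlt : π j < π i) 
    (hi : (π i).val < 2 * n)
    (h : ∀ x, x ≤ j → (π x).val < 2 * n) : False := by
  obtain ⟨x, hx⟩ := exists_pos π (2 * n) (by omega)
  obtain ⟨y, hy⟩ := exists_pos π (2 * n + 1) (by omega)
  have hxj : j < x := by
    by_contra hc
    have := h x (not_lt.1 hc)
    omega
  have hyj : j < y := by
    by_contra hc
    have := h y (not_lt.1 hc)
    omega
  have hne : x ≠ y := by rintro rfl; omega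
  rcases lt_or_gt_of_ne hne with hl | hl
  · exact hg.dual hij hxj hl hlt (by rw [Fin.lt_def]; omega) (by rw [Fin.lt_def]; omega)
  · exact hg.dual hij hyj hl hlt (by rw [Fin.lt_def]; omega) (by rw [Fin.lt_def]; omega)

theorem R_lt {n : ℕ} {π : Equiv.Perm (Fin (2 * n + 2))} (h : InR π) :
    (π (ix 0)).val < (π (ix 1)).val := by
  obtain ⟨hg, h0, h1⟩ := h
  by_contra hc
  have hne := val_ne π (a := ix 0) (b := ix 1) (by simp)
  refine no_dual hg (i := ix 0) (j := ix 1) (by simp [Fin.lt_def]) (by rw [Fin.lt_def]; omega) h0 ?_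
  intro x hx
  have hx' : x.val = 0 ∨ x.val = 1 := by
    have : x.val ≤ 1 := hx
    omega
  rcases hx' with hx' | hx'
  · rw [show x = ix 0 from Fin.ext hx']; omega
  · rw [show x = ix 1 from Fin.ext hx']; omega

theorem T_succ {n : ℕ} (hn : 1 ≤ n) {π : Equiv.Perm (Fin (2 * n + 2))} (h : InT π) :
    (π (ix 2)).val = (π (ix 1)).val + 1 := by
  obtain ⟨hg, h0, h1⟩ := h
  have hlt := R_lt (π := π) ⟨hg, h0, by omega⟩
  have hne := val_ne π (a := ix 1) (b := ix 2) (by simp)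
  have h12 : (π (ix 1)).val < (π (ix 2)).val := by
    by_contra hc
    refine no_dual hg (i := ix 1) (j := ix 2) (by simp [Fin.lt_def])
      (by rw [Fin.lt_def]; omega) h1 ?_
    intro x hx
    have hx' : x.val = 0 ∨ x.val = 1 ∨ x.val = 2 := by
      have : x.val ≤ 2 := hx
      omega
    rcases hx' with hx' | hx' | hx'
    · rw [show x = ix 0 from Fin.ext hx']; omega
    · rw [show x = ix 1 from Fin.ext hx']; omega
    · rw [show x = ix 2 from Fin.ext hx']; omega
  by_contra hc
  obtain ⟨x, hx⟩ := exists_pos π ((π (ix 1)).val + 1) (by omega)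
  have hx0 : x.val ≠ 0 := fun e => by
    rw [show x = ix 0 from Fin.ext e] at hx; omega
  have hx1 : x.val ≠ 1 := fun e => by
    rw [show x = ix 1 from Fin.ext e] at hx; omega
  have hx2 : x.val ≠ 2 := fun e => by
    rw [show x = ix 2 from Fin.ext e] at hx; omega
  refine hg.2 (ix 0) (ix 1) (ix 2) x ⟨?_, ?_, ?_, ?_, ?_, ?_⟩ <;> rw [Fin.lt_def] <;> (try simp only []) <;> omega

/-- The ascending duplication of the second entry. -/
theorem dup_good {n : ℕ} (hn : 2 ≤ n) {v : Fin (2 * n + 2)} {σ π}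
    (h : Rel (pSys n (ix 1)) (pSys n v) σ π) (hg : Good σ) (h01 : (π (ix 0)).val < (π (ix 1)).val)
    (h12 : (π (ix 2)).val = (π (ix 1)).val + 1) : Good π := by
  have hs : Sym π := h.sym_iff.2 hg.1
  refine ⟨hs, ?_⟩
  have r1 : (π (ix (2 * n))).val = 2 * n + 1 - (π (ix 1)).val := by
    have := congrArg Fin.val (hs (ix 1))
    rw [Fin.val_rev] at this
    rw [← show Fin.rev (ix 1 : Fin (2 * n + 2)) = ix (2 * n) from
      Fin.ext (by simp only [Fin.val_rev]; omega)]
    omega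
  have r2 : (π (ix (2 * n - 1))).val = 2 * n + 1 - (π (ix 2)).val := by
    have := congrArg Fin.val (hs (ix 2))
    rw [Fin.val_rev] at this
    rw [← show Fin.rev (ix 2 : Fin (2 * n + 2)) = ix (2 * n - 1) from
      Fin.ext (by simp only [Fin.val_rev]; omega)]
    omega
  have b2 := (π (ix 2)).isLt
  -- first: patterns avoiding position 1
  have off := h.off hg
  have offv : ∀ i j k l : Fin (2 * n + 2), Bad π i j k l → i.val ≠ 1 → j.val ≠ 1 → k.val ≠ 1 →
      l.val ≠ 1 → i.val ≠ 2 * n → j.val ≠ 2 * n → k.val ≠ 2 * n → l.val ≠ 2 * n → False := by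
    intro i j k l hb hi hj hk hl hi' hj' hk' hl'
    refine off i j k l ?_ hb
    intro x hx
    have hx' : x = i ∨ x = j ∨ x = k ∨ x = l := by simpa using hx
    have : x.val ≠ 1 ∧ x.val ≠ 2 * n := by
      rcases hx' with rfl | rfl | rfl | rfl <;> constructor <;> assumption
    simp only [pSys, Ne, Fin.ext_iff, Fin.val_rev]
    omega
  have off1 : ∀ i j k l : Fin (2 * n + 2), Bad π i j k l → i.val ≠ 1 → j.val ≠ 1 → False := by
    intro i j k l hb hi hj
    obtain ⟨hij, hjk, hkl, a, b, c⟩ := hb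
    simp only [Fin.lt_def] at hij hjk hkl a b c
    have hl := l.isLt
    by_cases hk2 : k.val = 2 * n
    · have hk2' : k = ix (2 * n) := Fin.ext hk2
      have hjm : j.val ≠ 2 * n - 1 := by
        intro e
        rw [show j = ix (2 * n - 1) from Fin.ext e] at b
        rw [hk2'] at c
        omega
      refine offv i j (ix (2 * n - 1)) l ⟨?_, ?_, ?_, ?_, ?_, ?_⟩ hi hj ?_ ?_ ?_ ?_ ?_ ?_
      case refine_6 =>
        rw [Fin.lt_def]
        have := val_ne π (a := ix (2 * n - 1)) (b := l) (by simp only []; omega)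
        rw [hk2'] at c
        omega
      all_goals first | assumption | ((try simp only [Fin.lt_def]); omega)
    · by_cases hl2 : l.val = 2 * n
      · have hl2' : l = ix (2 * n) := Fin.ext hl2
        have hkm : k.val ≠ 2 * n - 1 := by
          intro e
          have hh : 2 * n - 1 < 2 * n + 2 := by omega
          rw [show k = ix (2 * n - 1) hh from Fin.ext e, hl2'] at c
          omega
        have n1 := val_ne π (a := i) (b := ix (2 * n - 1)) (by simp only []; omega)
        have n2 := val_ne π (a := j) (b := ix (2 * n - 1)) (by simp only []; omega)
        rw [hl2'] at a b c
        refine offv i j k (ix (2 * n - 1)) ⟨?_, ?_, ?_, ?_, ?_, ?_⟩ hi hj ?_ ?_ ?_ ?_ ?_ ?_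
        all_goals first | assumption | ((try simp only [Fin.lt_def]); omega)
      · refine offv i j k l ⟨hij, hjk, hkl, a, b, c⟩ hi hj ?_ ?_ ?_ ?_ hk2 hl2 <;> omega
  rintro i j k l ⟨hij, hjk, hkl, a, b, c⟩
  simp only [Fin.lt_def] at hij hjk hkl a b c
  by_cases hi : i.val = 1
  · have hi' : i = ix 1 := Fin.ext hi
    by_cases hj : j.val = 2
    · refine off1 (ix 0) j k l ⟨?_, hjk, hkl, ?_, b, c⟩ (by simp) (by omega)
      · simp only [Fin.lt_def]; omega
      · rw [hi'] at a; simp only [Fin.lt_def]; omega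
    · have n1 := val_ne π (a := ix 2) (b := l) (by simp only []; omega)
      rw [hi'] at a
      refine off1 (ix 2) j k l ⟨?_, hjk, hkl, ?_, b, c⟩ (by simp) (by omega)
      · simp only [Fin.lt_def]; omega
      · simp only [Fin.lt_def]; omega
  · by_cases hj : j.val = 1
    · rw [show j = ix 1 from Fin.ext hj] at b
      have hk : k.val ≠ 2 := by
        intro e
        rw [show k = ix 2 from Fin.ext e] at c
        omega
      have n1 := val_ne π (a := ix 2) (b := l) (by simp only []; omega)
      refine off1 i (ix 2) k l ⟨?_, ?_, hkl, a, ?_, c⟩ hi (by simp)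
      all_goals simp only [Fin.lt_def]; omega
    · exact off1 i j k l ⟨hij, hjk, hkl, a, b, c⟩ hi hj

theorem count_T (n : ℕ) (hn : 1 ≤ n) :
    Set.ncard {σ : Equiv.Perm (Fin (2 * n + 2)) | InR σ} =
    Set.ncard {π : Equiv.Perm (Fin (2 * (n + 1) + 2)) | InT π} := by
  apply ncard_rel (fun σ π => Rel (pSys (n + 1) (ix 1)) (pSys (n + 1) (π (ix 1))) σ π)
  · intro σ hσ
    have h01 := R_lt hσ
    obtain ⟨hg, h0, h1⟩ := hσ
    let v : Fin (2 * (n + 1) + 2) :=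
      ix (if (σ (ix 1)).val < n + 1 then (σ (ix 1)).val else (σ (ix 1)).val + 1)
        (by split_ifs <;> omega)
    have hv : v.val = if (σ (ix 1)).val < n + 1 then (σ (ix 1)).val else (σ (ix 1)).val + 1 := rfl
    obtain ⟨π, hπ⟩ := exists_ins (pSys (n + 1) (ix 1)) (pSys (n + 1) v) (pSys_st _ _ _) σ
    have p1 : π (ix 1) = v := hπ.1
    have p0 := rel_val hπ (ix 0) (ix 0) (by simp only [eVal]; split_ifs <;> omega)
    have p2 := rel_val hπ (ix 1) (ix 2) (by simp only [eVal]; split_ifs <;> omega)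
    have p2' : (π (ix 2)).val = (π (ix 1)).val + 1 := by
      rw [p2, p1]; simp only [eVal]; split_ifs at * <;> omega
    have p01 : (π (ix 0)).val < (π (ix 1)).val := by
      rw [p0, p1]; simp only [eVal]; split_ifs at * <;> omega
    have p1l : (π (ix 1)).val < 2 * (n + 1) := by
      rw [p1]; split_ifs at hv <;> omega
    refine ⟨π, ⟨dup_good (by omega) hπ hg p01 p2', by omega, p1l⟩, ?_⟩
    rw [p1]; exact hπ
  · intro π hπ
    have h12 := T_succ (by omega) hπ
    obtain ⟨hg, h0, h1⟩ := hπ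
    have h01 := R_lt (π := π) ⟨hg, h0, by omega⟩
    obtain ⟨σ, hσ⟩ := exists_del (pSys (n + 1) (ix 1)) (pSys (n + 1) (π (ix 1))) π rfl hg.1
    refine ⟨σ, ?_, hσ⟩
    have p0 := rel_val hσ (ix 0) (ix 0) (by simp only [eVal]; split_ifs <;> omega)
    have p2 := rel_val hσ (ix 1) (ix 2) (by simp only [eVal]; split_ifs <;> omega)
    have b0 := (σ (ix 0)).isLt
    have b1 := (σ (ix 1)).isLt
    have hl : (σ (ix 0)).val < (σ (ix 1)).val := by
      simp only [eVal] at p0 p2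
      split_ifs at p0 p2 <;> omega
    have hl2 : (σ (ix 1)).val ≤ 2 * n := by
      simp only [eVal] at p2
      split_ifs at p2 <;> omega
    exact ⟨hσ.good hg, by omega, hl2⟩
  · intro σ _ π hπ π' hπ' h h'
    have h12 := T_succ (by omega) hπ
    have h12' := T_succ (by omega) hπ'
    have p2 := rel_val h (ix 1) (ix 2) (by simp only [eVal]; split_ifs <;> omega)
    have p2' := rel_val h' (ix 1) (ix 2) (by simp only [eVal]; split_ifs <;> omega)
    have : π (ix 1) = π' (ix 1) := by
      ext
      have := hπ.2.2
      have := hπ'.2.2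
      simp only [eVal] at p2 p2'
      split_ifs at p2 p2' <;> omega
    rw [← this] at h'
    exact h.uniq_right h'
  · intro σ _ σ' _ π _ h h'
    exact h.uniq_left h'

open Classical in
theorem ncard_sum {α : Type*} [Fintype α] (P : α → Prop) :
    Set.ncard {x | P x} = ∑ x, if P x then 1 else 0 := by
  rw [Set.ncard_eq_toFinset_card', ← Finset.card_filter]
  congr 1
  ext x
  simp

theorem eqA (k : ℕ) (hk : 1 ≤ k) : f (2 * k + 4) + f (2 * k) =
    3 * f (2 * k + 2) + Set.ncard {π : Equiv.Perm (Fin (2 * (k + 1) + 2)) | InR π} := by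
  classical
  have a1 := count0 (k + 1) 0 (2 * (k + 1) + 1) (by omega) (by omega) (by omega) (by omega)
  have a2 := count0 (k + 1) 0 (2 * (k + 1)) (by omega) (by omega) (by omega) (by omega)
  have a3 := count0 (k + 1) 1 (2 * (k + 1) + 1) (by omega) (by omega) (by omega) (by omega)
  have a4 := count23 (k + 1) (by omega)
  have a5 := count0 k 0 (2 * k + 1) (by omega) (by omega) (by omega) (by omega)
  have a6 : f (2 * k) = Set.ncard {π : Equiv.Perm (Fin (2 * (k + 1) + 2)) |
      Good π ∧ ((π (ix 0)).val = 2 * (k + 1) ∧ (π (ix 1)).val = 2 * (k + 1) + 1)} := by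
    rw [a5, ← a4]; rfl
  rw [a6, show f (2 * k + 4) = f (2 * (k + 1) + 2) from rfl,
    show 3 * f (2 * k + 2) = f (2 * (k + 1)) + f (2 * (k + 1)) + f (2 * (k + 1)) by
      rw [show f (2 * (k + 1)) = f (2 * k + 2) from rfl]; ring]
  nth_rewrite 1 [a1]
  nth_rewrite 1 [a2]
  nth_rewrite 1 [a3]
  rw [f_eq]
  simp only [ncard_sum, ← Finset.sum_add_distrib]
  apply Finset.sum_congr rfl
  intro π _
  have hne := val_ne π (a := ix 0) (b := ix 1) (by simp)
  have b0 := (π (ix 0)).isLt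
  have b1 := (π (ix 1)).isLt
  unfold InR
  by_cases hg : Good π
  · simp only [hg, true_and]
    split_ifs <;> omega
  · simp [hg]

theorem eqB (k : ℕ) (hk : 1 ≤ k) :
    Set.ncard {π : Equiv.Perm (Fin (2 * (k + 1) + 2)) | InR π} + f (2 * k) =
    f (2 * k + 2) + Set.ncard {π : Equiv.Perm (Fin (2 * (k + 1) + 2)) | InT π} := by
  classical
  have a1 := count0 (k + 1) 1 (2 * (k + 1)) (by omega) (by omega) (by omega) (by omega)
  have a4 := count14 (k + 1) (by omega)
  have a5 := count0 k 0 (2 * k + 1) (by omega) (by omega) (by omega) (by omega)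
  have a6 : f (2 * k) = Set.ncard {π : Equiv.Perm (Fin (2 * (k + 1) + 2)) |
      Good π ∧ ((π (ix 1)).val = 2 * (k + 1) ∧ (π (ix 0)).val = 2 * (k + 1) + 1)} := by
    rw [a5, ← a4]; rfl
  rw [a6, show f (2 * k + 2) = f (2 * (k + 1)) from rfl, a1]
  simp only [ncard_sum, ← Finset.sum_add_distrib]
  apply Finset.sum_congr rfl
  intro π _
  have hne := val_ne π (a := ix 0) (b := ix 1) (by simp)
  have b0 := (π (ix 0)).isLt
  have b1 := (π (ix 1)).isLt
  unfold InR InT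
  by_cases hg : Good π
  · simp only [hg, true_and]
    split_ifs <;> omega
  · simp [hg]

instance {M : ℕ} (π : Equiv.Perm (Fin M)) : Decidable (Good π) := by
  unfold Good Sym Bad; infer_instance

theorem f_two : f 2 = 2 := by
  rw [f_eq, Set.ncard_eq_toFinset_card']
  decide

theorem f_four : f 4 = 7 := by
  rw [f_eq, Set.ncard_eq_toFinset_card']
  decide +kernel

theorem R_two : Set.ncard {π : Equiv.Perm (Fin (2 * 1 + 2)) | InR π} = 2 := by
  have : ∀ π : Equiv.Perm (Fin (2 * 1 + 2)), Decidable (InR π) := fun π => by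
    unfold InR; infer_instance
  have h : {π : Equiv.Perm (Fin (2 * 1 + 2)) | InR π} = {π : Equiv.Perm (Fin (2 * 1 + 2)) |
    Good π ∧ (π (ix 0)).val < 2 * 1 ∧ (π (ix 1)).val ≤ 2 * 1} := rfl
  rw [h, Set.ncard_eq_toFinset_card']
  decide +kernel

theorem R_eq (k : ℕ) : Set.ncard {π : Equiv.Perm (Fin (2 * (k + 1) + 2)) | InR π} =
    f (2 * k + 2) := by
  induction k with
  | zero => exact R_two.trans f_two.symm
  | succ k ih =>
    have h1 := eqB (k + 1) (by omega)
    rw [← count_T (k + 1) (by omega), ih] at h1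
    have : f (2 * (k + 1)) = f (2 * k + 2) := rfl
    omega

/-- centre insertion -/
theorem centre_good (n : ℕ) (σ π) (h : Rel (cSys n) (cSys n) σ π) (hg : Good σ) (hs : Sym π) :
    Good π := by
  apply h.good_of hg hs
  have off := h.off hg
  have hc : (π (ix n)).val = n := congrArg Fin.val h.1
  have offv : ∀ i j k l : Fin (2 * n + 1), Bad π i j k l → i.val ≠ n → j.val ≠ n → k.val ≠ n →
      l.val ≠ n → False := by
    intro i j k l hb hi hj hk hl
    refine off i j k l ?_ hb
    intro x hx
    have hx' : x = i ∨ x = j ∨ x = k ∨ x = l := by simpa using hx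
    have : x.val ≠ n := by
      rcases hx' with rfl | rfl | rfl | rfl <;> assumption
    simp only [cSys, Ne, Fin.ext_iff, Fin.val_rev]
    omega
  have rv : ∀ x : Fin (2 * n + 1), (Fin.rev x).val = 2 * n - x.val := by
    intro x; rw [Fin.val_rev]; omega
  have rp : ∀ x : Fin (2 * n + 1), (π (Fin.rev x)).val = 2 * n - (π x).val := by
    intro x; rw [hs, rv]
  have inj : ∀ x y : Fin (2 * n + 1), x.val ≠ y.val → (π x).val ≠ (π y).val :=
    fun x y hxy he => hxy (perm_inj π he)
  -- two low elements before a high one, on the left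
  have A : ∀ i j k : Fin (2 * n + 1), i < j → j < k → k.val < n → (π i).val < n →
      (π j).val < n → n < (π k).val → False := by
    intro i j k hij hjk hk hi hj hkn
    simp only [Fin.lt_def] at hij hjk
    have b1 := (π i).isLt
    have b2 := (π j).isLt
    have b3 := (π k).isLt
    by_cases c1 : (π k).val + (π i).val < 2 * n ∧ (π k).val + (π j).val < 2 * n
    · refine offv i j k (Fin.rev k) ⟨hij, hjk, ?_, ?_, ?_, ?_⟩ ?_ ?_ ?_ ?_ <;>
        (try simp only [Fin.lt_def, rv, rp]) <;> omega
    · have n1 := inj i (Fin.rev k) (by rw [rv]; omega)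
      have n2 := inj j (Fin.rev k) (by rw [rv]; omega)
      rw [rp] at n1 n2
      by_cases c2 : 2 * n < (π k).val + (π i).val
      · refine offv i j k (Fin.rev i) ⟨hij, hjk, ?_, ?_, ?_, ?_⟩ ?_ ?_ ?_ ?_ <;>
          (try simp only [Fin.lt_def, rv, rp]) <;> omega
      · refine offv i j k (Fin.rev j) ⟨hij, hjk, ?_, ?_, ?_, ?_⟩ ?_ ?_ ?_ ?_ <;>
          (try simp only [Fin.lt_def, rv, rp]) <;> omega
  -- no inversion in the upper right quadrant
  have B : ∀ k l : Fin (2 * n + 1), n < k.val → k < l → n < (π l).val → π l < π k → False := by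
    intro k l hk hkl hl hlk
    simp only [Fin.lt_def] at hkl hlk
    have b1 := k.isLt
    have b2 := l.isLt
    have b3 := (π k).isLt
    refine offv (Fin.rev l) (Fin.rev k) k l ⟨?_, ?_, ?_, ?_, ?_, ?_⟩ ?_ ?_ ?_ ?_ <;>
      (try simp only [Fin.lt_def, rv, rp]) <;> omega
  rintro i j k l ⟨hij, hjk, hkl, a, b, c⟩ x hx
  simp only [Fin.lt_def] at hij hjk hkl a b c
  have hx' : (x = i ∨ x = j) ∨ x = k ∨ x = l := by simpa [or_assoc] using hx
  have b1 := l.isLt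
  suffices hxn : x.val ≠ n by
    simp only [cSys, Ne, Fin.ext_iff, Fin.val_rev]
    omega
  intro hxn
  have hxe : x = ix n := Fin.ext hxn
  rcases hx' with (rfl | rfl) | rfl | rfl
  · rw [hxe, hc] at a
    exact B k l (by omega) hkl a c
  · rw [hxe, hc] at b
    exact B k l (by omega) hkl b c
  · rw [hxe, hc] at c
    have hl : l.val ≠ n := by omega
    have e1 := rv l
    have e2 := rp l
    have e3 := rp j
    have e4 := rv j
    have hne : j.val ≠ (Fin.rev l).val := by
      intro he
      rw [Fin.ext he] at b
      omega
    by_cases hjl : j.val < (Fin.rev l).val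
    · refine offv i j (Fin.rev l) l ⟨hij, hjl, ?_, a, b, ?_⟩ ?_ ?_ ?_ hl <;>
        (try simp only [Fin.lt_def]) <;> omega
    · refine offv i j (Fin.rev j) l ⟨hij, ?_, ?_, a, b, ?_⟩ ?_ ?_ ?_ hl <;>
        (try simp only [Fin.lt_def]) <;> omega
  · rw [hxe, hc] at a b c
    exact A i j k hij hjk (by omega) a b c

theorem odd_eq (n : ℕ) : f (2 * n) = f (2 * n + 1) := by
  have h := ncard_sys (cSys n) (cSys n) Iff.rfl (fun _ => True)
    (fun _ => True) (fun σ π hr => Iff.rfl) (centre_good n)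
  have hc : ∀ π : Equiv.Perm (Fin (2 * n + 1)), Good π → π (cSys n).p = (cSys n).p := by
    intro π hg
    have h1 := congrArg Fin.val (hg.1 (cSys n).p)
    have h2 : Fin.rev (cSys n).p = (cSys n).p :=
      Fin.ext (by rw [Fin.val_rev]; simp only [cSys]; omega)
    rw [h2, Fin.val_rev] at h1
    apply Fin.ext
    have h3 : (cSys n).p.val = n := rfl
    omega
  rw [f_eq, f_eq]
  simp only [and_true] at h
  rw [h]
  congr 1
  ext π
  exact ⟨fun x => x.1, fun x => ⟨x, hc π x⟩⟩

end Aux18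

theorem stmt_18 :
    (∀ n : ℕ, 1 ≤ n → f (2 * n) = f (2 * n + 1)) ∧
      f 2 = 2 ∧ f 4 = 7 ∧
      ∀ n : ℕ, 3 ≤ n → f (2 * n) + f (2 * n - 4) = 4 * f (2 * n - 2) := by
  refine ⟨fun n _ => Aux18.odd_eq n, Aux18.f_two, Aux18.f_four, ?_⟩
  intro n hn
  obtain ⟨k, rfl⟩ : ∃ k, n = k + 2 := ⟨n - 2, by omega⟩
  have h1 := Aux18.eqA k (by omega)
  rw [Aux18.R_eq] at h1
  rw [show 2 * (k + 2) - 4 = 2 * k by omega, show 2 * (k + 2) - 2 = 2 * k + 2 by omega,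
    show 2 * (k + 2) = 2 * k + 4 by ring, h1]
  ring
end
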